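/- arXiv:1010.1077 — 4 statements merged into one kernel-verified Lean document; each statement's English description precedes it below -/
import Mathlib

section
/- Let d, s ∈ ℕ. Then there exists a constant V(d,s) > 0, depending only on d and s, such that every bounded polyhedron P ∈ 𝒫_ifm(s,d) (an integral (s·ℤ^d)-free polytope, inclusion-maximal among integral (s·ℤ^d)-free polyhedra) satisfies vol(P) ≤ V(d,s), where vol denotes the d-dimensional Lebesgue measure. -/
open Set

/-- The set of integer points `ℤ^d` inside `ℝ^d`. -/
def intPts (d : ℕ) : Set (Fin d → ℝ) := {x | ∀ i, ∃ z : ℤ, x i = (z : ℝ)}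

/-- The lattice `Λ = s·ℤ^d` inside `ℝ^d`. -/
def sLat (d s : ℕ) : Set (Fin d → ℝ) := {x | ∀ i, ∃ z : ℤ, x i = (s : ℝ) * (z : ℝ)}

/-- A polyhedron: a finite intersection of closed halfspaces. -/
def IsPolyhedron {d : ℕ} (P : Set (Fin d → ℝ)) : Prop :=
  ∃ (n : ℕ) (A : Fin n → Fin d → ℝ) (b : Fin n → ℝ),
    P = {x | ∀ i, (∑ j, A i j * x j) ≤ b i}

/-- An integral set: it equals the convex hull of its integer points. -/
def IsIntegralPoly {d : ℕ} (P : Set (Fin d → ℝ)) : Prop :=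
  P = convexHull ℝ (P ∩ intPts d)

/-- The affine map `x ↦ U·x + t` with integer matrix `U` and translation `t : ℝ^d`. -/
noncomputable def affMap {d : ℕ} (U : Matrix (Fin d) (Fin d) ℤ) (t : Fin d → ℝ)
    (x : Fin d → ℝ) : Fin d → ℝ := fun i => (∑ j, (U i j : ℝ) * x j) + t i

/-- An integral `Λ`-free polyhedron, where `Λ = s·ℤ^d`. -/
def IsIntLatFree (d s : ℕ) (P : Set (Fin d → ℝ)) : Prop :=
  IsPolyhedron P ∧ IsIntegralPoly P ∧ interior P ∩ sLat d s = ∅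

/-- Membership in `𝒫_ifm(s,d)`: an integral `Λ`-free polyhedron which is
inclusion-maximal among integral `Λ`-free polyhedra. -/
def MemPifm (d s : ℕ) (P : Set (Fin d → ℝ)) : Prop :=
  IsIntLatFree d s P ∧ ∀ Q : Set (Fin d → ℝ), IsIntLatFree d s Q → P ⊆ Q → P = Q

/-- Simultaneous Dirichlet approximation with a bound on the multiplier that depends only on the
number of reals approximated. -/
theorem exists_simultaneous_approx (n : ℕ) {δ : ℝ} (hδ : 0 < δ) :
    ∃ K : ℕ, 0 < K ∧ ∀ (ι : Type) [Fintype ι], Fintype.card ι ≤ n → ∀ β : ι → ℝ,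
      ∃ (k : ℕ) (p : ι → ℤ), 1 ≤ k ∧ k ≤ K ∧ ∀ i, |k * β i - p i| ≤ δ := by
  classical
  obtain ⟨M, hM⟩ := exists_nat_gt (1 / δ)
  have hM0 : (0 : ℝ) < M := lt_trans (by positivity) hM
  have hM1 : 0 < M := by exact_mod_cast hM0
  refine ⟨M ^ n, by positivity, fun ι _ hι β => ?_⟩
  have hlt : ∀ (k : ℕ) (i : ι), ⌊M * Int.fract (k * β i)⌋₊ < M := fun k i => by
    rw [Nat.floor_lt (by positivity)]
    nlinarith [Int.fract_lt_one (k * β i)]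
  let f : Fin (M ^ n + 1) → ι → Fin M := fun k i => ⟨⌊M * Int.fract (k * β i)⌋₊, hlt k i⟩
  have key : ∃ k l : Fin (M ^ n + 1), k < l ∧ f k = f l := by
    obtain ⟨k, l, hkl, h⟩ := Fintype.exists_ne_map_eq_of_card_lt f (by
      simpa using Nat.lt_succ_of_le (Nat.pow_le_pow_right hM1 hι))
    rcases lt_or_gt_of_ne hkl with h' | h'
    exacts [⟨k, l, h', h⟩, ⟨l, k, h', h.symm⟩]
  obtain ⟨k, l, hkl, h⟩ := key
  have hkl' : (k : ℕ) < l := hkl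
  refine ⟨l - k, fun i => ⌊l * β i⌋ - ⌊k * β i⌋, by omega, by omega, fun i => ?_⟩
  have h1 : ⌊M * Int.fract (k * β i)⌋₊ = ⌊M * Int.fract (l * β i)⌋₊ :=
    congrArg Fin.val (congrFun h i)
  have h2 := Nat.floor_le (a := M * Int.fract (k * β i)) (by positivity)
  have h3 := Nat.lt_floor_add_one (M * Int.fract (k * β i))
  have h4 := Nat.floor_le (a := M * Int.fract (l * β i)) (by positivity)
  have h5 := Nat.lt_floor_add_one (M * Int.fract (l * β i))
  rw [h1] at h2 h3
  have h6 : (1 : ℝ) < M * δ := by rwa [div_lt_iff₀ hδ] at hM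
  have e : ((l - k : ℕ) : ℝ) * β i - ((⌊l * β i⌋ - ⌊k * β i⌋ : ℤ) : ℝ)
      = Int.fract (l * β i) - Int.fract (k * β i) := by
    rw [Nat.cast_sub hkl'.le, Int.fract, Int.fract]
    push_cast
    ring
  rw [e, abs_le]
  constructor <;> nlinarith

/-- Each step either makes all coordinates at least `c` or doubles the lower bound `m` on them. -/
theorem exists_doubling_step (n : ℕ) {s : ℕ} (hs : 1 ≤ s) (r : ℕ) :
    ∀ t : ℝ, 0 < t → ∃ c : ℝ, 0 < c ∧ ∀ (ι : Type) [Fintype ι], Fintype.card ι ≤ n →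
      ∀ (β : ι → ℝ) (m : ℝ), 0 < m → (∀ i, m ≤ β i) → ∑ i, β i = 1 →
        {i | β i < t}.ncard ≤ r →
        ∃ (k : ℕ) (a : ι → ℤ), ∑ i, a i = -k ∧
          ∀ i, min c (2 * m) ≤ β i + s * (k * β i + a i) := by
  classical
  have hs' : (1 : ℝ) ≤ s := by exact_mod_cast hs
  induction r with
  | zero =>
    refine fun t ht => ⟨t, ht, fun ι _ _ β m _ _ _ hr => ⟨0, 0, by simp, fun i => ?_⟩⟩
    have h : {i | β i < t} = ∅ := (ncard_eq_zero (toFinite _)).1 (Nat.le_zero.1 hr)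
    have hi : i ∉ {i | β i < t} := by simp [h]
    simp only [mem_ofPred_eq, not_lt] at hi
    simpa using Or.inl hi
  | succ r ih =>
    intro t ht
    obtain ⟨δ, hδ, hδt, hδn⟩ : ∃ δ : ℝ, 0 < δ ∧ s * δ ≤ t / 2 ∧ n * δ < 1 := by
      refine ⟨min (t / (2 * s)) (1 / (n + 1)), by positivity, ?_, ?_⟩
      · calc (s : ℝ) * min (t / (2 * s)) (1 / (n + 1)) ≤ s * (t / (2 * s)) := by
              gcongr
              exact min_le_left _ _
          _ = t / 2 := by field_simp
      · calc (n : ℝ) * min (t / (2 * s)) (1 / (n + 1)) ≤ n * (1 / (n + 1)) := by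
              gcongr
              exact min_le_right _ _
          _ < 1 := by
              rw [mul_one_div, div_lt_one (by positivity)]
              linarith
    obtain ⟨K, hK0, hK⟩ := exists_simultaneous_approx n hδ
    have hK0' : (0 : ℝ) < K := by exact_mod_cast hK0
    have ht' : 0 < min (t / 2) (δ / K) := by positivity
    obtain ⟨c, hc, hcs⟩ := ih _ ht'
    refine ⟨min c (min (t / 2) (δ / K)), by positivity, fun ι _ hι β m hm hβ hsum hr => ?_⟩
    by_cases hgap : ∃ i, β i < t ∧ min (t / 2) (δ / K) ≤ β i
    · obtain ⟨j, hjt, hj⟩ := hgap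
      have hlt : {i | β i < min (t / 2) (δ / K)}.ncard < {i | β i < t}.ncard := by
        refine ncard_lt_ncard ⟨fun i hi => ?_, fun h => ?_⟩ (toFinite _)
        · have h1 : β i < min (t / 2) (δ / K) := hi
          have := h1.trans_le (min_le_left _ _)
          show β i < t
          linarith
        · exact absurd (h hjt) (not_lt.2 hj)
      obtain ⟨k, a, ha, hk⟩ := hcs ι hι β m hm hβ hsum (by omega)
      exact ⟨k, a, ha, fun i => le_trans (min_le_min_right _ (min_le_left _ _)) (hk i)⟩
    · push Not at hgap
      obtain ⟨k, p, hk1, hkK, hp⟩ := hK ι hι β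
      have hk1' : (1 : ℝ) ≤ k := by exact_mod_cast hk1
      have hkK' : (k : ℝ) ≤ K := by exact_mod_cast hkK
      let q : ι → ℤ := fun i => if β i < t then 0 else p i
      have hq : ∀ i, |k * β i - q i| ≤ δ := fun i => by
        by_cases hi : β i < t
        · have hpos : 0 < β i := hm.trans_le (hβ i)
          have h1 : β i ≤ δ / K := ((hgap i hi).trans_le (min_le_right _ _)).le
          rw [le_div_iff₀ hK0'] at h1
          simp only [q, if_pos hi, Int.cast_zero, sub_zero]
          rw [abs_of_nonneg (by positivity)]
          nlinarith
        · simpa only [q, if_neg hi] using hp i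
      have hqsum : ∑ i, q i = k := by
        have h1 : |((k - ∑ i, q i : ℤ) : ℝ)| < 1 := by
          calc |((k - ∑ i, q i : ℤ) : ℝ)| = |∑ i, (k * β i - q i)| := by
                rw [Finset.sum_sub_distrib, ← Finset.mul_sum, hsum]
                push_cast
                ring_nf
            _ ≤ ∑ i, |k * β i - q i| := Finset.abs_sum_le_sum_abs _ _
            _ ≤ ∑ _i : ι, δ := Finset.sum_le_sum fun i _ => hq i
            _ = Fintype.card ι * δ := by simp
            _ ≤ n * δ := by gcongr
            _ < 1 := hδn
        have h2 : |(k - ∑ i, q i : ℤ)| < 1 := by exact_mod_cast h1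
        have h3 := Int.abs_lt_one_iff.1 h2
        omega
      refine ⟨k, fun i => -q i, by simp [hqsum], fun i => ?_⟩
      by_cases hi : β i < t
      · refine (min_le_right _ _).trans ?_
        simp only [q, if_pos hi, neg_zero, Int.cast_zero, add_zero]
        have h1 : (1 : ℝ) ≤ s * k := one_le_mul_of_one_le_of_one_le hs' hk1'
        nlinarith [hβ i]
      · refine (min_le_left _ _).trans ((min_le_right _ _).trans ((min_le_left _ _).trans ?_))
        have h1 := (abs_le.1 (hq i)).1
        push_cast
        nlinarith

/-- A strictly positive barycentric vector can be moved, by an integral multiple of itself and an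
integral vector divisible by `s`, to one whose coordinates are bounded below uniformly. -/
theorem exists_uniform_lower_bound (n : ℕ) {s : ℕ} (hs : 1 ≤ s) :
    ∃ c : ℝ, 0 < c ∧ c ≤ 1 ∧ ∀ (ι : Type) [Fintype ι], Fintype.card ι ≤ n →
      ∀ β : ι → ℝ, (∀ i, 0 < β i) → ∑ i, β i = 1 →
        ∃ (k : ℕ) (a : ι → ℤ), ∑ i, a i = -k ∧ ∀ i, c ≤ β i + s * (k * β i + a i) := by
  obtain ⟨c₀, hc₀, hstep⟩ := exists_doubling_step n hs n 1 one_pos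
  obtain ⟨c, hc, hc1, hcc⟩ : ∃ c : ℝ, 0 < c ∧ c ≤ 1 ∧ c ≤ c₀ :=
    ⟨min c₀ 1, by positivity, min_le_right _ _, min_le_left _ _⟩
  refine ⟨c, hc, hc1, fun ι _ hι => ?_⟩
  have main : ∀ (N : ℕ) (β : ι → ℝ), (∀ i, c / 2 ^ N ≤ β i) → ∑ i, β i = 1 →
      ∃ (k : ℕ) (a : ι → ℤ), ∑ i, a i = -k ∧ ∀ i, c ≤ β i + s * (k * β i + a i) := by
    intro N
    induction N with
    | zero => exact fun β hβ _ => ⟨0, 0, by simp, fun i => by simpa using hβ i⟩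
    | succ N ih =>
      intro β hβ hsum
      obtain ⟨k, a, ha, hk⟩ := hstep ι hι β (c / 2 ^ (N + 1)) (by positivity) hβ hsum
        ((ncard_le_card _).trans (by simpa using hι))
      have ha' : ∑ i, (a i : ℝ) = -k := by exact_mod_cast ha
      have hlow : ∀ i, c / 2 ^ N ≤ β i + s * (k * β i + a i) := fun i => by
        refine le_trans (le_min ?_ (le_of_eq ?_)) (hk i)
        · exact (div_le_self hc.le (one_le_pow₀ (by norm_num))).trans hcc
        · rw [pow_succ]
          field_simp
      have hsum' : ∑ i, (β i + s * (k * β i + a i)) = 1 := by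
        rw [Finset.sum_add_distrib, ← Finset.mul_sum, Finset.sum_add_distrib, ← Finset.mul_sum,
          hsum, ha']
        ring
      obtain ⟨l, b, hb, hl⟩ := ih _ hlow hsum'
      refine ⟨k + l + s * k * l, fun i => (1 + s * l) * a i + b i, ?_, fun i => ?_⟩
      · rw [Finset.sum_add_distrib, ← Finset.mul_sum, ha, hb]
        push_cast
        ring
      · refine (hl i).trans_eq ?_
        push_cast
        ring
  intro β hβ hsum
  obtain ⟨m, hm, hmβ⟩ : ∃ m : ℝ, 0 < m ∧ ∀ i, m ≤ β i := by
    cases isEmpty_or_nonempty ι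
    · exact ⟨1, one_pos, fun i => isEmptyElim i⟩
    · obtain ⟨j, hj⟩ := Finite.exists_min β
      exact ⟨β j, hβ j, hj⟩
  obtain ⟨N, hN⟩ := pow_unbounded_of_one_lt (c / m) (one_lt_two (α := ℝ))
  refine main N β (fun i => le_trans ?_ (hmβ i)) hsum
  rw [div_lt_iff₀ hm] at hN
  rw [div_le_iff₀ (by positivity)]
  linarith

theorem exists_pos_combination {d : ℕ} {S : Set (Fin d → ℝ)} {x : Fin d → ℝ}
    (hx : x ∈ convexHull ℝ S) :
    ∃ (ι : Type) (_ : Fintype ι) (v : ι → Fin d → ℝ) (w : ι → ℝ), Fintype.card ι ≤ d + 1 ∧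
      (∀ i, v i ∈ S) ∧ (∀ i, 0 < w i) ∧ ∑ i, w i = 1 ∧ ∑ i, w i • v i = x := by
  obtain ⟨ι, _, v, w, hv, haff, hw, hsum, hx⟩ := eq_pos_convex_span_of_mem_convexHull hx
  refine ⟨ι, inferInstance, v, w, ?_, fun i => hv ⟨i, rfl⟩, hw, hsum, hx⟩
  refine haff.card_le_finrank_succ.trans ?_
  simpa using Submodule.finrank_le (vectorSpan ℝ (range v))

/-- If a convex combination of points of a convex set lies in the interior, so does every
combination of the same points with uniformly positive weights. -/
theorem sum_smul_mem_interior {d : ℕ} {P : Set (Fin d → ℝ)} (hP : Convex ℝ P) {ι : Type}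
    [Fintype ι] {v : ι → Fin d → ℝ} (hv : ∀ i, v i ∈ P) {β γ : ι → ℝ} (hβ : ∀ i, 0 ≤ β i)
    (hβ1 : ∑ i, β i = 1) (hinterior : ∑ i, β i • v i ∈ interior P) {c : ℝ} (hc : 0 < c) (hc1 : c < 1)
    (hγ : ∀ i, c ≤ γ i) (hγ1 : ∑ i, γ i = 1) : ∑ i, γ i • v i ∈ interior P := by
  have hβle : ∀ i, β i ≤ 1 := fun i =>
    hβ1 ▸ Finset.single_le_sum (fun j _ => hβ j) (Finset.mem_univ i)
  have h1c : 0 < 1 - c := by linarith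
  have hr : ∑ i, ((γ i - c * β i) / (1 - c)) • v i ∈ P := by
    refine hP.sum_mem (fun i _ => ?_) ?_ fun i _ => hv i
    · exact div_nonneg (by nlinarith [hγ i, hβle i]) h1c.le
    · rw [← Finset.sum_div, Finset.sum_sub_distrib, ← Finset.mul_sum, hβ1, hγ1, mul_one,
        div_self h1c.ne']
  have h := hP.combo_interior_self_mem_interior hinterior hr hc h1c.le (by ring)
  convert h using 1
  rw [Finset.smul_sum, Finset.smul_sum, ← Finset.sum_add_distrib]
  refine Finset.sum_congr rfl fun i _ => ?_
  rw [smul_smul, smul_smul, ← add_smul, mul_div_cancel₀ _ h1c.ne']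
  congr 1
  ring

theorem exists_interior_eq_combo {d : ℕ} {P : Set (Fin d → ℝ)} {y : Fin d → ℝ}
    (hy : y ∈ interior P) (b : Fin d → ℝ) :
    ∃ q ∈ P, ∃ ε : ℝ, 0 < ε ∧ ε < 1 ∧ y = ε • b + (1 - ε) • q := by
  have hcont : Filter.Tendsto (fun η : ℝ => y + η • (y - b)) (nhdsWithin 0 (Ioi 0)) (nhds y) := by
    have : Continuous fun η : ℝ => y + η • (y - b) := by fun_prop
    have h := this.tendsto 0
    simp only [zero_smul, add_zero] at h
    exact h.mono_left nhdsWithin_le_nhds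
  obtain ⟨η, hη, hη0⟩ := ((hcont.eventually (mem_interior_iff_mem_nhds.1 hy)).and
    self_mem_nhdsWithin).exists
  have hη0' : 0 < η := hη0
  refine ⟨_, hη, η / (1 + η), by positivity, ?_, ?_⟩
  · rw [div_lt_one (by positivity)]
    linarith
  · ext i
    simp only [Pi.add_apply, Pi.smul_apply, Pi.sub_apply, smul_eq_mul]
    field_simp
    ring

/-- An integral convex set containing a long lattice segment in direction `u`, some line of
direction `u` through a point of `s·ℤ^d` meeting its interior, has a point of `s·ℤ^d` in its
interior. -/
theorem exists_mem_interior_inter_sLat (d : ℕ) {s : ℕ} (hs : 1 ≤ s) :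
    ∃ N : ℕ, 0 < N ∧ ∀ (P : Set (Fin d → ℝ)), Convex ℝ P → P ⊆ convexHull ℝ (P ∩ intPts d) →
      ∀ (u : Fin d → ℝ), u ∈ intPts d → ∀ x₀ ∈ P, x₀ + (N : ℝ) • u ∈ P →
        ∀ l ∈ sLat d s, ∀ τ : ℝ, l + τ • u ∈ interior P → (interior P ∩ sLat d s).Nonempty := by
  obtain ⟨c, hc, hc1, hcs⟩ := exists_uniform_lower_bound ((d + 1) + (d + 1) + (d + 1)) hs
  have hs' : (0 : ℝ) < s := by exact_mod_cast hs
  obtain ⟨N, hN⟩ := exists_nat_gt (s / (c / 2))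
  have hN0 : (0 : ℝ) < N := lt_trans (by positivity) hN
  rw [div_lt_iff₀ (by positivity)] at hN
  refine ⟨N, by exact_mod_cast hN0, fun P hP hPint u hu x₀ hx₀ hx₁ l hl τ hy => ?_⟩
  obtain ⟨q, hq, ε, hε, hε1, hyq⟩ :=
    exists_interior_eq_combo hy ((1 / 2 : ℝ) • x₀ + (1 / 2 : ℝ) • (x₀ + (N : ℝ) • u))
  obtain ⟨ι₀, _, v₀, w₀, hι₀, hv₀, hw₀, hsum₀, hcomb₀⟩ := exists_pos_combination (hPint hx₀)
  obtain ⟨ι₁, _, v₁, w₁, hι₁, hv₁, hw₁, hsum₁, hcomb₁⟩ := exists_pos_combination (hPint hx₁)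
  obtain ⟨ι₂, _, v₂, w₂, hι₂, hv₂, hw₂, hsum₂, hcomb₂⟩ := exists_pos_combination (hPint hq)
  have h1ε : 0 < 1 - ε := by linarith
  let v : (ι₀ ⊕ ι₁) ⊕ ι₂ → Fin d → ℝ := Sum.elim (Sum.elim v₀ v₁) v₂
  let β : (ι₀ ⊕ ι₁) ⊕ ι₂ → ℝ := Sum.elim (Sum.elim (fun i => ε * (1 / 2) * w₀ i)
    (fun i => ε * (1 / 2) * w₁ i)) (fun i => (1 - ε) * w₂ i)
  let γ₀ : (ι₀ ⊕ ι₁) ⊕ ι₂ → ℝ := Sum.elim (Sum.elim w₀ 0) 0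
  let γ₁ : (ι₀ ⊕ ι₁) ⊕ ι₂ → ℝ := Sum.elim (Sum.elim 0 w₁) 0
  have hv : ∀ i, v i ∈ P ∩ intPts d := by
    rintro ((i | i) | i)
    exacts [hv₀ i, hv₁ i, hv₂ i]
  have hβ : ∀ i, 0 < β i := by
    rintro ((i | i) | i)
    exacts [mul_pos (by positivity) (hw₀ i), mul_pos (by positivity) (hw₁ i), mul_pos h1ε (hw₂ i)]
  have hβ1 : ∑ i, β i = 1 := by
    simp only [β, Fintype.sum_sum_type, Sum.elim_inl, Sum.elim_inr, ← Finset.mul_sum, hsum₀, hsum₁,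
      hsum₂]
    ring
  have hβv : ∑ i, β i • v i = l + τ • u := by
    simp only [β, v, Fintype.sum_sum_type, Sum.elim_inl, Sum.elim_inr, mul_smul,
      ← Finset.smul_sum, hcomb₀, hcomb₁, hcomb₂]
    rw [hyq]
    module
  have hγ₀ : ∀ i, 0 ≤ γ₀ i := by
    rintro ((i | i) | i)
    exacts [(hw₀ i).le, le_rfl, le_rfl]
  have hγ₁ : ∀ i, 0 ≤ γ₁ i := by
    rintro ((i | i) | i)
    exacts [le_rfl, (hw₁ i).le, le_rfl]
  have hγ₀1 : ∑ i, γ₀ i = 1 := by simp [γ₀, Fintype.sum_sum_type, hsum₀]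
  have hγ₁1 : ∑ i, γ₁ i = 1 := by simp [γ₁, Fintype.sum_sum_type, hsum₁]
  have hγ₀v : ∑ i, γ₀ i • v i = x₀ := by simp [γ₀, v, Fintype.sum_sum_type, hcomb₀]
  have hγ₁v : ∑ i, γ₁ i • v i = x₀ + (N : ℝ) • u := by
    simp [γ₁, v, Fintype.sum_sum_type, hcomb₁]
  have hγ₀le : ∀ i, γ₀ i ≤ 1 := fun i =>
    hγ₀1 ▸ Finset.single_le_sum (fun j _ => hγ₀ j) (Finset.mem_univ i)
  obtain ⟨k, a, ha, hk⟩ := hcs _ (by simp only [Fintype.card_sum]; omega) β hβ hβ1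
  have ha' : ∑ i, (a i : ℝ) = -k := by exact_mod_cast ha
  set σ : ℝ := (1 + s * k) * τ with hσ
  let z : ℤ := ⌈σ / s⌉
  have hz1 : σ ≤ s * z := by
    have := Int.le_ceil (σ / s)
    rwa [div_le_iff₀' hs'] at this
  have hz2 : s * z < σ + s := by
    have := Int.ceil_lt_add_one (σ / s)
    have h := mul_lt_mul_of_pos_left this hs'
    rwa [mul_add, mul_div_cancel₀ _ hs'.ne', mul_one] at h
  obtain ⟨t, ht0, ht1, ht⟩ : ∃ t : ℝ, 0 ≤ t ∧ t ≤ 1 ∧ c / 2 * t * N = s * z - σ := by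
    refine ⟨(s * z - σ) / (c / 2 * N), div_nonneg (by linarith) (by positivity), ?_, by field_simp⟩
    rw [div_le_one (by positivity)]
    linarith
  have hmem := sum_smul_mem_interior hP (fun i => (hv i).1) (fun i => (hβ i).le) hβ1
    (hβv ▸ hy) (c := c / 2) (by positivity) (by linarith)
    (γ := fun i => β i + s * (k * β i + a i) + c / 2 * t * (γ₁ i - γ₀ i)) (fun i => by
      have h1 := hk i
      have h2 : c / 2 * t * (γ₁ i - γ₀ i) ≥ - (c / 2) := by
        have h3 : t * γ₀ i ≤ 1 := mul_le_one₀ ht1 (hγ₀ i) (hγ₀le i)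
        have h4 : 0 ≤ t * γ₁ i := mul_nonneg ht0 (hγ₁ i)
        nlinarith
      linarith) (by
      simp only [Finset.sum_add_distrib, ← Finset.mul_sum, Finset.sum_sub_distrib, hβ1, ha', hγ₀1,
        hγ₁1]
      ring)
  refine ⟨_, hmem, ?_⟩
  have hval : ∑ i, (β i + s * (k * β i + a i) + c / 2 * t * (γ₁ i - γ₀ i)) • v i
      = (1 + s * k : ℝ) • l + (s : ℝ) • ∑ i, (a i : ℝ) • v i + (s * z : ℝ) • u := by
    have h : ∀ i, (β i + s * (k * β i + a i) + c / 2 * t * (γ₁ i - γ₀ i)) • v i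
        = (1 + s * k : ℝ) • (β i • v i) + (s : ℝ) • ((a i : ℝ) • v i)
          + (c / 2 * t) • (γ₁ i • v i - γ₀ i • v i) := fun i => by module
    simp only [h, Finset.sum_add_distrib, ← Finset.smul_sum, Finset.sum_sub_distrib, hβv, hγ₀v,
      hγ₁v, add_sub_cancel_left]
    have h2 : (s * z : ℝ) = c / 2 * t * N + (1 + s * k) * τ := by linarith
    rw [h2]
    module
  rw [hval]
  intro j
  obtain ⟨lz, hlz⟩ := hl j
  obtain ⟨uz, huz⟩ := hu j
  choose vz hvz using fun i => (hv i).2 j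
  refine ⟨(1 + s * k) * lz + ∑ i, a i * vz i + z * uz, ?_⟩
  simp only [Pi.add_apply, Pi.smul_apply, Finset.sum_apply, smul_eq_mul, hlz, huz, hvz]
  push_cast
  ring

/-- A set of large volume contains the endpoints of a long lattice segment. -/
theorem exists_long_lattice_segment (d : ℕ) {N : ℕ} (hN : 0 < N) :
    ∃ V : ℝ, 0 < V ∧ ∀ P : Set (Fin d → ℝ), MeasureTheory.NullMeasurableSet P →
      ENNReal.ofReal V < MeasureTheory.volume P →
        ∃ u ∈ intPts d, u ≠ 0 ∧ ∃ x ∈ P, x + (N : ℝ) • u ∈ P := by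
  have hN' : (N : ℝ) ≠ 0 := by exact_mod_cast hN.ne'
  let b : Module.Basis (Fin d) ℝ (Fin d → ℝ) :=
    (Pi.basisFun ℝ (Fin d)).isUnitSMul (w := fun _ => (N : ℝ)) fun _ => hN'.isUnit
  have hb : ∀ i, b i = (N : ℝ) • Pi.single i 1 := fun i => by
    simp [b, Module.Basis.isUnitSMul_apply]
  have hfin : MeasureTheory.volume (ZSpan.fundamentalDomain b) < ⊤ :=
    (ZSpan.fundamentalDomain_isBounded b).measure_lt_top
  refine ⟨(MeasureTheory.volume (ZSpan.fundamentalDomain b)).toReal + 1, by positivity,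
    fun P hP hvol => ?_⟩
  have hlt : MeasureTheory.volume (ZSpan.fundamentalDomain b) < MeasureTheory.volume P := by
    refine lt_of_le_of_lt ?_ hvol
    rw [← ENNReal.ofReal_toReal hfin.ne]
    exact ENNReal.ofReal_le_ofReal (by simp [ENNReal.toReal_ofReal])
  have : Countable (Submodule.span ℤ (range b)).toAddSubgroup :=
    inferInstanceAs (Countable (Submodule.span ℤ (range b)))
  obtain ⟨x, y, hxy, hdisj⟩ := MeasureTheory.exists_pair_mem_lattice_not_disjoint_vadd
    (ZSpan.isAddFundamentalDomain' b MeasureTheory.volume) hP hlt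
  obtain ⟨_, ⟨p, hp, rfl⟩, ⟨q, hq, hpq⟩⟩ := Set.not_disjoint_iff.1 hdisj
  have hlat : ∀ w ∈ Submodule.span ℤ (range b), ∃ u ∈ intPts d, w = (N : ℝ) • u := by
    intro w hw
    induction hw using Submodule.span_induction with
    | mem w hw =>
      obtain ⟨i, rfl⟩ := hw
      refine ⟨Pi.single i 1, fun j => ?_, hb i⟩
      by_cases h : j = i
      · subst h
        exact ⟨1, by simp⟩
      · exact ⟨0, by simp [h]⟩
    | zero => exact ⟨0, fun j => ⟨0, by simp⟩, by simp⟩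
    | add w₁ w₂ _ _ h₁ h₂ =>
      obtain ⟨u₁, hu₁, rfl⟩ := h₁
      obtain ⟨u₂, hu₂, rfl⟩ := h₂
      refine ⟨u₁ + u₂, fun j => ?_, (smul_add _ _ _).symm⟩
      obtain ⟨z₁, h₁⟩ := hu₁ j
      obtain ⟨z₂, h₂⟩ := hu₂ j
      exact ⟨z₁ + z₂, by simp [h₁, h₂]⟩
    | smul n w _ h =>
      obtain ⟨u, hu, rfl⟩ := h
      refine ⟨n • u, fun j => ?_, (smul_comm _ _ _)⟩
      obtain ⟨z, h⟩ := hu j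
      exact ⟨n * z, by simp [h]⟩
  obtain ⟨u, hu, hxu⟩ := hlat ((x : Fin d → ℝ) - y) (Submodule.sub_mem _ x.2 y.2)
  have hpq' : (y : Fin d → ℝ) + q = x + p := hpq
  refine ⟨u, hu, fun h0 => hxy (Subtype.ext (sub_eq_zero.1 ?_)), p, hp, ?_⟩
  · rw [hxu, h0, smul_zero]
  · rw [← hxu]
    convert hq using 1
    rw [add_sub, sub_eq_iff_eq_add, add_comm p, ← hpq', add_comm]

/-- The union of all lines of direction `u` that meet `P`. -/
def lineSat {d : ℕ} (u : Fin d → ℝ) (P : Set (Fin d → ℝ)) : Set (Fin d → ℝ) :=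
  {x | ∃ t : ℝ, x + t • u ∈ P}

theorem subset_lineSat {d : ℕ} (u : Fin d → ℝ) (P : Set (Fin d → ℝ)) : P ⊆ lineSat u P :=
  fun x hx => ⟨0, by simpa using hx⟩

theorem convex_lineSat {d : ℕ} (u : Fin d → ℝ) {P : Set (Fin d → ℝ)} (hP : Convex ℝ P) :
    Convex ℝ (lineSat u P) := by
  rintro x ⟨t, hx⟩ y ⟨r, hy⟩ a b ha hb hab
  refine ⟨a * t + b * r, ?_⟩
  convert hP hx hy ha hb hab using 1
  module

theorem isOpen_lineSat {d : ℕ} (u : Fin d → ℝ) {P : Set (Fin d → ℝ)} (hP : IsOpen P) :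
    IsOpen (lineSat u P) := by
  have h : lineSat u P = ⋃ t : ℝ, (fun x => x + t • u) ⁻¹' P := by
    ext x
    simp [lineSat]
  rw [h]
  exact isOpen_iUnion fun t => hP.preimage (by fun_prop)

theorem interior_lineSat_subset {d : ℕ} (u : Fin d → ℝ) {P : Set (Fin d → ℝ)} (hP : Convex ℝ P)
    (hne : (interior P).Nonempty) : interior (lineSat u P) ⊆ lineSat u (interior P) := by
  have hsub : lineSat u P ⊆ closure (lineSat u (interior P)) := by
    rintro x ⟨t, hx⟩
    have hx' : x + t • u ∈ closure (interior P) := by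
      rw [hP.closure_interior_eq_closure_of_nonempty_interior hne]
      exact subset_closure hx
    have hmaps : MapsTo (fun y : Fin d → ℝ => y - t • u) (interior P) (lineSat u (interior P)) :=
      fun y hy => ⟨t, by simpa using hy⟩
    have h := map_mem_closure (by fun_prop) hx' hmaps
    simpa using h
  have hopen : IsOpen (lineSat u (interior P)) := isOpen_lineSat u isOpen_interior
  refine (interior_mono hsub).trans ?_
  rw [(convex_lineSat u hP.interior).interior_closure_eq_interior_of_nonempty_interior,
    hopen.interior_eq]
  rw [hopen.interior_eq]
  exact hne.mono (subset_lineSat u _)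

theorem isIntegralPoly_lineSat {d : ℕ} {u : Fin d → ℝ} (hu : u ∈ intPts d) {P : Set (Fin d → ℝ)}
    (hP : IsIntegralPoly P) : IsIntegralPoly (lineSat u P) := by
  have hconv : Convex ℝ P := hP ▸ convex_convexHull ℝ _
  refine Subset.antisymm ?_ (convexHull_min inter_subset_left (convex_lineSat u hconv))
  have hvert : ∀ v ∈ P ∩ intPts d, ∀ z : ℤ, v + (z : ℝ) • u ∈ lineSat u P ∩ intPts d := by
    rintro v ⟨hvP, hv⟩ z
    refine ⟨⟨-z, by simpa using hvP⟩, fun j => ?_⟩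
    obtain ⟨a, ha⟩ := hv j
    obtain ⟨b, hb⟩ := hu j
    exact ⟨a + z * b, by simp [ha, hb]⟩
  have hline : ∀ r : ℝ, P ⊆ (fun x => x + r • u) ⁻¹' convexHull ℝ (lineSat u P ∩ intPts d) := by
    intro r
    nth_rewrite 1 [hP]
    refine convexHull_min (fun v hv => ?_) ((convex_convexHull ℝ _).translate_preimage_left _)
    have h := convex_convexHull ℝ (lineSat u P ∩ intPts d)
      (subset_convexHull ℝ _ (hvert v hv ⌊r⌋)) (subset_convexHull ℝ _ (hvert v hv (⌊r⌋ + 1)))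
      (sub_nonneg.2 (Int.fract_lt_one r).le) (Int.fract_nonneg r) (by ring)
    show v + r • u ∈ convexHull ℝ (lineSat u P ∩ intPts d)
    convert h using 1
    rw [Int.cast_add, Int.cast_one]
    nth_rewrite 1 [← Int.floor_add_fract r]
    module
  rintro x ⟨t, hx⟩
  simpa [add_assoc] using hline (-t) hx

theorem exists_between_families {ι : Type} [Finite ι] (L U : Set ι) (f g : ι → ℝ)
    (h : ∀ i ∈ L, ∀ j ∈ U, f i ≤ g j) : ∃ t : ℝ, (∀ i ∈ L, f i ≤ t) ∧ ∀ j ∈ U, t ≤ g j := by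
  rcases L.eq_empty_or_nonempty with rfl | hL
  · obtain ⟨t, ht⟩ := (U.toFinite.image g).bddBelow
    exact ⟨t, by simp, fun j hj => ht ⟨j, hj, rfl⟩⟩
  · obtain ⟨i, hi, hmax⟩ := exists_max_image L f L.toFinite hL
    exact ⟨f i, hmax, fun j hj => h i hi j hj⟩

/-- Fourier–Motzkin elimination of the direction `u`. -/
theorem isPolyhedron_lineSat {d : ℕ} (u : Fin d → ℝ) {P : Set (Fin d → ℝ)} (hP : IsPolyhedron P) :
    IsPolyhedron (lineSat u P) := by
  obtain ⟨n, A, b, rfl⟩ := hP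
  let α : Fin n → ℝ := fun i => ∑ j, A i j * u j
  let ν : Fin n → Fin n → ℝ := fun i k =>
    if i = k ∧ α i = 0 then 1 else if 0 < α i ∧ α k < 0 then -α k else 0
  let μ : Fin n → Fin n → ℝ := fun i k => if 0 < α i ∧ α k < 0 then α i else 0
  refine ⟨n * n, fun m j => ν (finProdFinEquiv.symm m).1 (finProdFinEquiv.symm m).2 *
      A (finProdFinEquiv.symm m).1 j + μ (finProdFinEquiv.symm m).1 (finProdFinEquiv.symm m).2 *
      A (finProdFinEquiv.symm m).2 j, fun m => ν (finProdFinEquiv.symm m).1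
      (finProdFinEquiv.symm m).2 * b (finProdFinEquiv.symm m).1 +
      μ (finProdFinEquiv.symm m).1 (finProdFinEquiv.symm m).2 * b (finProdFinEquiv.symm m).2, ?_⟩
  ext x
  have hlin : ∀ (i : Fin n) (t : ℝ),
      ∑ j, A i j * (x + t • u) j = ∑ j, A i j * x j + t * α i := fun i t => by
    simp only [α, Finset.mul_sum, ← Finset.sum_add_distrib, Pi.add_apply, Pi.smul_apply,
      smul_eq_mul]
    exact Finset.sum_congr rfl fun j _ => by ring
  have hcomb : ∀ i k, ∑ j, (ν i k * A i j + μ i k * A k j) * x j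
      = ν i k * ∑ j, A i j * x j + μ i k * ∑ j, A k j * x j := fun i k => by
    simp only [Finset.mul_sum, ← Finset.sum_add_distrib]
    exact Finset.sum_congr rfl fun j _ => by ring
  simp only [lineSat, mem_ofPred_eq, hlin, hcomb, finProdFinEquiv.symm.forall_congr_left,
    Equiv.symm_symm, Equiv.symm_apply_apply, Prod.forall]
  constructor
  · rintro ⟨t, ht⟩ i k
    have hi := ht i
    have hk := ht k
    by_cases h1 : i = k ∧ α i = 0
    · have h2 : ¬ (0 < α i ∧ α k < 0) := fun h => h.1.ne' h1.2
      simp only [ν, μ, if_pos h1, if_neg h2]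
      rw [h1.2] at hi
      linarith
    · by_cases h2 : 0 < α i ∧ α k < 0
      · simp only [ν, μ, if_neg h1, if_pos h2]
        nlinarith [mul_le_mul_of_nonneg_left hi (neg_pos.2 h2.2).le,
          mul_le_mul_of_nonneg_left hk h2.1.le]
      · simp [ν, μ, if_neg h1, if_neg h2]
  · intro h
    obtain ⟨t, hL, hU⟩ := exists_between_families {k | α k < 0} {i | 0 < α i}
      (fun k => (b k - ∑ j, A k j * x j) / α k) (fun i => (b i - ∑ j, A i j * x j) / α i)
      (fun k hk i hi => by
        have hk' : α k < 0 := hk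
        have hi' : 0 < α i := hi
        have h1 : ¬ (i = k ∧ α i = 0) := fun h => hi'.ne' h.2
        have h3 := h i k
        simp only [ν, μ, if_neg h1, if_pos (And.intro hi' hk')] at h3
        rw [le_div_iff₀ hi', div_mul_eq_mul_div, div_le_iff_of_neg hk']
        linarith)
    refine ⟨t, fun i => ?_⟩
    rcases lt_trichotomy (α i) 0 with h0 | h0 | h0
    · have := hL i h0
      rw [div_le_iff_of_neg h0] at this
      linarith
    · have h3 := h i i
      simp only [ν, μ, h0, lt_irrefl, and_self, if_true, if_false] at h3
      rw [h0]
      linarith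
    · have := hU i h0
      rw [le_div_iff₀ h0] at this
      linarith

theorem not_isBounded_lineSat {d : ℕ} {u : Fin d → ℝ} (hu : u ≠ 0) {P : Set (Fin d → ℝ)}
    (hne : P.Nonempty) : ¬ Bornology.IsBounded (lineSat u P) := by
  intro hbdd
  obtain ⟨R, hR⟩ := isBounded_iff_forall_norm_le.1 hbdd
  obtain ⟨x, hx⟩ := hne
  have hu' : 0 < ‖u‖ := norm_pos_iff.2 hu
  have h1 : x + ((R + ‖x‖ + 1) / ‖u‖) • u ∈ lineSat u P :=
    ⟨-((R + ‖x‖ + 1) / ‖u‖), by simpa using hx⟩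
  have h2 := hR _ h1
  have h3 := hR x (subset_lineSat u P hx)
  have h4 := norm_sub_le (x + ((R + ‖x‖ + 1) / ‖u‖) • u) x
  have h5 := norm_nonneg x
  rw [add_sub_cancel_left, norm_smul, norm_div, norm_norm, div_mul_cancel₀ _ hu'.ne',
    Real.norm_of_nonneg (by linarith)] at h4
  linarith

/-- The volume of bounded elements of `𝒫_ifm(s,d)` is bounded by a constant
depending only on `d` and `s`. -/
theorem Pifm_volume_bound (d s : ℕ) (hs : 1 ≤ s) :
    ∃ V : ℝ, 0 < V ∧
      ∀ P : Set (Fin d → ℝ), MemPifm d s P → Bornology.IsBounded P →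
        MeasureTheory.volume P ≤ ENNReal.ofReal V := by
  obtain ⟨N, hN, hlat⟩ := exists_mem_interior_inter_sLat d hs
  obtain ⟨V, hV, hseg⟩ := exists_long_lattice_segment d hN
  refine ⟨V, hV, fun P ⟨⟨hpoly, hintegral, hfree⟩, hmax⟩ hbdd => ?_⟩
  by_contra! hvol
  have hconv : Convex ℝ P := hintegral ▸ convex_convexHull ℝ _
  have hne : (interior P).Nonempty := by
    rw [nonempty_iff_ne_empty]
    intro h
    have h1 : MeasureTheory.volume P ≤ MeasureTheory.volume (frontier P) := by
      refine MeasureTheory.measure_mono ?_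
      rw [frontier, h, sdiff_empty]
      exact subset_closure
    rw [hconv.addHaar_frontier MeasureTheory.volume] at h1
    exact absurd (hvol.trans_le h1) not_lt_zero
  obtain ⟨u, hu, hu0, x, hx, hxu⟩ := hseg P (hconv.nullMeasurableSet _) hvol
  have hQ : IsIntLatFree d s (lineSat u P) := by
    refine ⟨isPolyhedron_lineSat u hpoly, isIntegralPoly_lineSat hu hintegral, ?_⟩
    rw [eq_empty_iff_forall_notMem]
    rintro l ⟨hl, hls⟩
    obtain ⟨τ, hτ⟩ := interior_lineSat_subset u hconv hne hl
    exact (hlat P hconv hintegral.subset u hu x hx hxu l hls τ hτ).ne_empty hfree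
  have hPQ := hmax _ hQ (subset_lineSat u P)
  exact not_isBounded_lineSat hu0 ⟨x, hx⟩ (hPQ ▸ hbdd)
end

section
/- Let d, s ∈ ℕ, Λ = s·ℤ^d, and a ∈ Λ. Let 𝒳^d(a) be the class of all integral polyhedra P ⊆ ℝ^d such that a lies on the relative boundary of P and relint(P) ∩ Λ ≠ ∅, partially ordered by P ⪯ Q iff relint(P) ⊆ relint(Q). Let P be a minimal element of this poset. Then: (I) P is a simplex of some dimension k ∈ {1, …, d}; (II) a is a vertex of P; (III) relint(P) ∩ Λ consists of precisely one point; (IV) the facet F of the simplex P opposite to the vertex a satisfies F ∩ ℤ^d = vert(F), i.e., the only integer points of F are its vertices. -/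
open Set

/-- Membership in `𝒳^d(a)`: an integral polyhedron with `a` on its relative boundary
and at least one point of `Λ = s·ℤ^d` in its relative interior. -/
def MemX (d s : ℕ) (a : Fin d → ℝ) (P : Set (Fin d → ℝ)) : Prop :=
  IsPolyhedron P ∧ IsIntegralPoly P ∧ a ∈ intrinsicFrontier ℝ P ∧
    (intrinsicInterior ℝ P ∩ sLat d s).Nonempty

section RelativeInterior

variable {E : Type*} [NormedAddCommGroup E] [NormedSpace ℝ E]

lemma mem_intrinsicInterior_iff_nhds {C : Set E} {x : E} :
    x ∈ intrinsicInterior ℝ C ↔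
      x ∈ C ∧ ∃ U ∈ nhds x, ∀ y ∈ U, y ∈ affineSpan ℝ C → y ∈ C := by
  rw [mem_intrinsicInterior]
  constructor
  · rintro ⟨y, hy, rfl⟩
    refine ⟨interior_subset (s := ((↑) : affineSpan ℝ C → E) ⁻¹' C) hy, ?_⟩
    rw [mem_interior_iff_mem_nhds, nhds_subtype_eq_comap, Filter.mem_comap] at hy
    obtain ⟨U, hU, h⟩ := hy
    exact ⟨U, hU, fun z hz hz' => h (a := ⟨z, hz'⟩) hz⟩
  · rintro ⟨hx, U, hU, h⟩
    refine ⟨⟨x, subset_affineSpan ℝ C hx⟩, ?_, rfl⟩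
    rw [mem_interior_iff_mem_nhds, nhds_subtype_eq_comap, Filter.mem_comap]
    exact ⟨U, hU, fun z hz => h z hz z.2⟩

lemma Convex.combo_mem_intrinsicInterior {C : Set E} (hC : Convex ℝ C) {z y : E}
    (hz : z ∈ intrinsicInterior ℝ C) (hy : y ∈ C) {t : ℝ} (ht0 : 0 < t) (ht1 : t ≤ 1) :
    AffineMap.lineMap y z t ∈ intrinsicInterior ℝ C := by
  rw [mem_intrinsicInterior_iff_nhds] at hz ⊢
  obtain ⟨hzC, U, hU, h⟩ := hz
  refine ⟨hC.lineMap_mem hy hzC ⟨ht0.le, ht1⟩, (fun x => AffineMap.lineMap y x t⁻¹) ⁻¹' U, ?_, ?_⟩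
  · have hc : Continuous fun x : E => (AffineMap.lineMap y x t⁻¹ : E) := by
      simp only [AffineMap.lineMap_apply_module]
      fun_prop
    refine hc.continuousAt.preimage_mem_nhds ?_
    have : (AffineMap.lineMap y (AffineMap.lineMap y z t : E) t⁻¹ : E) = z := by
      simp only [AffineMap.lineMap_apply, vsub_eq_sub, vadd_eq_add, add_sub_cancel_right, smul_smul]
      rw [inv_mul_cancel₀ ht0.ne']
      simp
    rwa [this]
  · intro x hx hxs
    have h1 := h _ hx (AffineMap.lineMap_mem _ (subset_affineSpan ℝ C hy) hxs)
    have : (AffineMap.lineMap y (AffineMap.lineMap y x t⁻¹ : E) t : E) = x := by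
      simp only [AffineMap.lineMap_apply, vsub_eq_sub, vadd_eq_add, add_sub_cancel_right, smul_smul]
      rw [mul_inv_cancel₀ ht0.ne']
      simp
    rw [← this]
    exact hC.lineMap_mem hy h1 ⟨ht0.le, ht1⟩

lemma exists_add_smul_sub_mem_of_mem_intrinsicInterior {C : Set E} {x y : E}
    (hx : x ∈ intrinsicInterior ℝ C) (hy : y ∈ C) : ∃ ε > (0 : ℝ), x + ε • (x - y) ∈ C := by
  rw [mem_intrinsicInterior_iff_nhds] at hx
  obtain ⟨hxC, U, hU, h⟩ := hx
  have hc : Continuous fun ε : ℝ => x + ε • (x - y) := by fun_prop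
  have h0 : (fun ε : ℝ => x + ε • (x - y)) ⁻¹' U ∈ nhds (0 : ℝ) :=
    hc.continuousAt.preimage_mem_nhds (by simpa using hU)
  obtain ⟨ε, hε, hball⟩ := Metric.mem_nhds_iff.1 h0
  refine ⟨ε / 2, by positivity, h _ (hball ?_) ?_⟩
  · rw [Metric.mem_ball, Real.dist_0_eq_abs, abs_of_pos (by positivity)]
    linarith
  · rw [add_comm]
    exact AffineSubspace.vadd_mem_of_mem_direction (Submodule.smul_mem _ _
      (AffineSubspace.vsub_mem_direction (subset_affineSpan ℝ C hxC) (subset_affineSpan ℝ C hy)))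
      (subset_affineSpan ℝ C hxC)

lemma Convex.mem_intrinsicInterior_of_add_smul_sub_mem {C : Set E} (hC : Convex ℝ C) {x z : E}
    (hz : z ∈ intrinsicInterior ℝ C) {ε : ℝ} (hε : 0 < ε) (h : x + ε • (x - z) ∈ C) :
    x ∈ intrinsicInterior ℝ C := by
  have key := hC.combo_mem_intrinsicInterior hz h (t := ε / (1 + ε)) (by positivity)
    (by rw [div_le_one (by positivity)]; linarith)
  convert key using 1
  simp only [AffineMap.lineMap_apply_module]
  have h1 : (1 - ε / (1 + ε)) = 1 / (1 + ε) := by field_simp; ring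
  rw [h1]
  have h2 : (1 + ε) ≠ 0 := by positivity
  match_scalars <;> field_simp
  ring

lemma Convex.mem_intrinsicInterior_iff [FiniteDimensional ℝ E] {C : Set E} (hC : Convex ℝ C)
    {x : E} : x ∈ intrinsicInterior ℝ C ↔
      x ∈ C ∧ ∀ y ∈ C, ∃ ε > (0 : ℝ), x + ε • (x - y) ∈ C := by
  constructor
  · intro hx
    exact ⟨intrinsicInterior_subset hx,
      fun y hy => exists_add_smul_sub_mem_of_mem_intrinsicInterior hx hy⟩
  · rintro ⟨hx, h⟩
    obtain ⟨z, hz⟩ := Set.Nonempty.intrinsicInterior hC ⟨x, hx⟩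
    obtain ⟨ε, hε, h⟩ := h z (intrinsicInterior_subset hz)
    exact hC.mem_intrinsicInterior_of_add_smul_sub_mem hz hε h

lemma intrinsicInterior_subset_of_subset {C D : Set E}
    (hD : Convex ℝ D) (hCD : C ⊆ D) {z : E} (hz : z ∈ intrinsicInterior ℝ C)
    (hz' : z ∈ intrinsicInterior ℝ D) : intrinsicInterior ℝ C ⊆ intrinsicInterior ℝ D := by
  intro x hx
  obtain ⟨ε, hε, h⟩ :=
    exists_add_smul_sub_mem_of_mem_intrinsicInterior hx (intrinsicInterior_subset hz)
  exact hD.mem_intrinsicInterior_of_add_smul_sub_mem hz' hε (hCD h)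

end RelativeInterior

/-- A version of Carathéodory's theorem for conic combinations in which the total weight
does not increase. -/
lemma exists_linearIndependent_conic_combination {ι E : Type*} [AddCommGroup E] [Module ℝ E]
    (v : ι → E) (S : Finset ι) (μ : ι → ℝ) (hμ : ∀ i ∈ S, 0 ≤ μ i) :
    ∃ T ⊆ S, ∃ ν : ι → ℝ, (∀ i ∈ T, 0 < ν i) ∧ ∑ i ∈ T, ν i ≤ ∑ i ∈ S, μ i ∧
      ∑ i ∈ T, ν i • v i = ∑ i ∈ S, μ i • v i ∧ LinearIndepOn ℝ v (T : Set ι) := by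
  classical
  induction S using Finset.strongInduction generalizing μ with
  | H S ih =>
  by_cases h0 : ∃ i ∈ S, μ i = 0
  · obtain ⟨i, hi, hi0⟩ := h0
    obtain ⟨T, hT, ν, h1, h2, h3, h4⟩ := ih (S.erase i) (Finset.erase_ssubset hi) μ
      (fun j hj => hμ j (Finset.mem_of_mem_erase hj))
    refine ⟨T, hT.trans (Finset.erase_subset _ _), ν, h1, ?_, ?_, h4⟩
    · rwa [Finset.sum_erase _ hi0] at h2
    · rwa [Finset.sum_erase _ (by simp [hi0])] at h3
  push Not at h0
  by_cases hli : LinearIndepOn ℝ v (S : Set ι)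
  · exact ⟨S, subset_rfl, μ, fun i hi => (hμ i hi).lt_of_ne' (h0 i hi), le_rfl, rfl, hli⟩
  have hg : ∃ g : ι → ℝ, ∑ i ∈ S, g i • v i = 0 ∧ 0 ≤ ∑ i ∈ S, g i ∧ ∃ i ∈ S, g i ≠ 0 := by
    rw [linearIndepOn_finset_iff] at hli
    push Not at hli
    obtain ⟨g, hg, hne⟩ := hli
    rcases le_total 0 (∑ i ∈ S, g i) with h | h
    · exact ⟨g, hg, h, hne⟩
    · refine ⟨-g, ?_, ?_, ?_⟩
      · simp [hg]
      · simpa using h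
      · simpa using hne
  obtain ⟨g, hg, hsum, j, hj, hj0⟩ := hg
  have hpos : ∃ i ∈ S, 0 < g i := by
    by_contra! hcon
    have := Finset.sum_lt_sum hcon ⟨j, hj, (hcon j hj).lt_of_ne hj0⟩
    simp only [Finset.sum_const_zero] at this
    linarith
  obtain ⟨i, hi, hmin⟩ := Finset.exists_min_image (S.filter fun i => 0 < g i)
    (fun i => μ i / g i) (by simpa [Finset.Nonempty] using hpos)
  simp only [Finset.mem_filter] at hi hmin
  set t := μ i / g i with ht
  have ht0 : 0 ≤ t := div_nonneg (hμ i hi.1) hi.2.le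
  obtain ⟨T, hT, ν, h1, h2, h3, h4⟩ := ih (S.erase i) (Finset.erase_ssubset hi.1)
    (fun k => μ k - t * g k) (fun k hk => by
      have hk := Finset.mem_of_mem_erase hk
      rcases le_or_gt (g k) 0 with h | h
      · nlinarith [hμ k hk]
      · have := hmin k ⟨hk, h⟩
        rw [le_div_iff₀ h] at this
        linarith)
  have hz : μ i - t * g i = 0 := by
    rw [ht, div_mul_cancel₀ _ hi.2.ne', sub_self]
  refine ⟨T, hT.trans (Finset.erase_subset _ _), ν, h1, h2.trans ?_, h3.trans ?_, h4⟩
  · rw [Finset.sum_erase (f := fun k => μ k - t * g k) S hz, Finset.sum_sub_distrib, ← Finset.mul_sum]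
    nlinarith
  · rw [Finset.sum_erase (f := fun k => (μ k - t * g k) • v k) S (by rw [hz, zero_smul])]
    simp_rw [sub_smul, mul_smul]
    rw [Finset.sum_sub_distrib, ← Finset.smul_sum, hg, smul_zero, sub_zero]

section Simplex

variable {ι E : Type*} [Fintype ι]

lemma eq_of_sum_smul_eq [AddCommGroup E] [Module ℝ E] {v : ι → E} (hv : LinearIndependent ℝ v)
    {w u : ι → ℝ} (h : ∑ i, w i • v i = ∑ i, u i • v i) : w = u := by
  have := Fintype.linearIndependent_iff.1 hv (fun i => w i - u i)
    (by simp_rw [sub_smul]; rw [Finset.sum_sub_distrib, h, sub_self])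
  exact funext fun i => sub_eq_zero.1 (this i)

lemma mem_convexHull_insert_range_iff [AddCommGroup E] [Module ℝ E] {a : E} {p : ι → E} {x : E} :
    x ∈ convexHull ℝ (insert a (range p)) ↔
      ∃ w : ι → ℝ, (∀ i, 0 ≤ w i) ∧ ∑ i, w i ≤ 1 ∧ x = a + ∑ i, w i • (p i - a) := by
  constructor
  · have hconv : Convex ℝ {x : E | ∃ w : ι → ℝ, (∀ i, 0 ≤ w i) ∧ ∑ i, w i ≤ 1 ∧
        x = a + ∑ i, w i • (p i - a)} := by
      rintro x ⟨w, hw, hw1, rfl⟩ y ⟨u, hu, hu1, rfl⟩ s t hs ht hst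
      refine ⟨fun i => s * w i + t * u i, fun i => ?_, ?_, ?_⟩
      · have := hw i
        have := hu i
        positivity
      · rw [Finset.sum_add_distrib, ← Finset.mul_sum, ← Finset.mul_sum]
        nlinarith
      · simp_rw [add_smul, mul_smul]
        rw [Finset.sum_add_distrib, ← Finset.smul_sum, ← Finset.smul_sum, smul_add, smul_add]
        rw [add_add_add_comm, ← add_smul, hst, one_smul]
    refine fun hx => convexHull_min (insert_subset ?_ ?_) hconv hx
    · exact ⟨0, by simp, by simp, by simp⟩
    · classical
      rintro _ ⟨i, rfl⟩
      exact ⟨Pi.single i 1, fun j => by by_cases h : j = i <;> simp [h],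
        by simp, by simp [Pi.single_apply, ite_smul]⟩
  · rintro ⟨w, hw, hw1, rfl⟩
    refine mem_convexHull_of_exists_fintype (ι := Option ι)
      (fun i => i.elim (1 - ∑ i, w i) w) (fun i => i.elim a p) ?_ ?_ ?_ ?_
    · rintro (_ | i)
      · simpa using hw1
      · exact hw i
    · simp
    · rintro (_ | i)
      · exact mem_insert _ _
      · exact mem_insert_of_mem _ ⟨i, rfl⟩
    · simp only [Fintype.sum_option, Option.elim_none, Option.elim_some, smul_sub,
        Finset.sum_sub_distrib, sub_smul, one_smul, Finset.sum_smul]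
      abel

lemma coord_bounds_of_mem_convexHull [AddCommGroup E] [Module ℝ E] {a : E} {p : ι → E}
    (hp : LinearIndependent ℝ fun i => p i - a) {w : ι → ℝ}
    (h : a + ∑ i, w i • (p i - a) ∈ convexHull ℝ (insert a (range p))) :
    (∀ i, 0 ≤ w i) ∧ ∑ i, w i ≤ 1 := by
  obtain ⟨u, hu, hu1, h⟩ := mem_convexHull_insert_range_iff.1 h
  rw [eq_of_sum_smul_eq hp (add_left_cancel h)]
  exact ⟨hu, hu1⟩

lemma mem_intrinsicInterior_simplex_iff [NormedAddCommGroup E] [NormedSpace ℝ E]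
    [FiniteDimensional ℝ E] {a : E} {p : ι → E}
    (hp : LinearIndependent ℝ fun i => p i - a) {x : E} :
    x ∈ intrinsicInterior ℝ (convexHull ℝ (insert a (range p))) ↔
      ∃ w : ι → ℝ, (∀ i, 0 < w i) ∧ ∑ i, w i < 1 ∧ x = a + ∑ i, w i • (p i - a) := by
  rw [(convex_convexHull ℝ _).mem_intrinsicInterior_iff]
  have hext : ∀ (w u : ι → ℝ) (ε : ℝ), a + ∑ i, w i • (p i - a) +
      ε • (a + ∑ i, w i • (p i - a) - (a + ∑ i, u i • (p i - a))) =
      a + ∑ i, (w i + ε * (w i - u i)) • (p i - a) := by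
    intro w u ε
    simp_rw [add_smul, mul_smul, sub_smul]
    rw [Finset.sum_add_distrib, ← Finset.smul_sum, Finset.sum_sub_distrib]
    simp only [add_sub_add_left_eq_sub, add_assoc]
  constructor
  · rintro ⟨hx, h⟩
    obtain ⟨w, hw, hw1, rfl⟩ := mem_convexHull_insert_range_iff.1 hx
    refine ⟨w, fun i => ?_, ?_, rfl⟩
    · classical
      obtain ⟨ε, hε, hm⟩ := h (p i) (subset_convexHull ℝ _ (mem_insert_of_mem _ ⟨i, rfl⟩))
      have hpi : p i = a + ∑ j, (Pi.single i 1 : ι → ℝ) j • (p j - a) := by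
        simp [Pi.single_apply, ite_smul]
      rw [hpi, hext] at hm
      have := (coord_bounds_of_mem_convexHull hp hm).1 i
      simp only [Pi.single_eq_same] at this
      by_contra! hcon
      nlinarith
    · obtain ⟨ε, hε, hm⟩ := h a (subset_convexHull ℝ _ (mem_insert _ _))
      have h0 := hext w 0 ε
      simp only [Pi.zero_apply, zero_smul, Finset.sum_const_zero, add_zero] at h0
      rw [h0] at hm
      have := (coord_bounds_of_mem_convexHull hp hm).2
      simp only [sub_zero, Finset.sum_add_distrib, ← Finset.mul_sum] at this
      by_contra! hcon
      nlinarith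
  · rintro ⟨w, hw, hw1, rfl⟩
    refine ⟨mem_convexHull_insert_range_iff.2 ⟨w, fun i => (hw i).le, hw1.le, rfl⟩, ?_⟩
    intro y hy
    obtain ⟨u, hu, hu1, rfl⟩ := mem_convexHull_insert_range_iff.1 hy
    have h1 : ∀ᶠ ε in nhds (0 : ℝ), ∀ i, 0 < w i + ε * (w i - u i) := by
      rw [Filter.eventually_all]
      intro i
      have hc : Continuous fun ε : ℝ => w i + ε * (w i - u i) := by fun_prop
      exact hc.continuousAt.eventually (lt_mem_nhds (by simpa using hw i))
    have h2 : ∀ᶠ ε in nhds (0 : ℝ), ∑ i, (w i + ε * (w i - u i)) < 1 := by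
      have hc : Continuous fun ε : ℝ => ∑ i, (w i + ε * (w i - u i)) := by fun_prop
      exact hc.continuousAt.eventually (gt_mem_nhds (by simpa using hw1))
    have h3 := ((h1.and h2).filter_mono nhdsWithin_le_nhds).and
      (self_mem_nhdsWithin (s := Ioi (0 : ℝ)))
    obtain ⟨ε, ⟨h1, h2⟩, hε⟩ := h3.exists
    refine ⟨ε, hε, ?_⟩
    rw [hext]
    exact mem_convexHull_insert_range_iff.2 ⟨_, fun i => (h1 i).le, h2.le, rfl⟩

end Simplex

lemma LinearIndependent.exists_coord {ι E : Type*} [Fintype ι] [AddCommGroup E] [Module ℝ E]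
    {v : ι → E} (hv : LinearIndependent ℝ v) :
    ∃ g : E →ₗ[ℝ] ι → ℝ, ∀ w : ι → ℝ, g (∑ i, w i • v i) = w := by
  obtain ⟨g, hg⟩ := LinearMap.exists_leftInverse_of_injective (Fintype.linearCombination ℝ v)
    (LinearMap.ker_eq_bot.2 (linearIndependent_iff_injective_fintypeLinearCombination.1 hv))
  exact ⟨g, fun w => by simpa [Fintype.linearCombination_apply] using LinearMap.congr_fun hg w⟩

section Polyhedron

variable {d : ℕ}

lemma isPolyhedron_setOf_forall_le {ι : Type*} [Fintype ι] (f : ι → (Fin d → ℝ) →ₗ[ℝ] ℝ)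
    (b : ι → ℝ) : IsPolyhedron {x | ∀ i, f i x ≤ b i} := by
  let e := Fintype.equivFin ι
  refine ⟨Fintype.card ι, fun i j => f (e.symm i) fun k => if j = k then 1 else 0,
    fun i => b (e.symm i), ?_⟩
  ext x
  simp only [mem_ofPred_eq]
  rw [e.symm.forall_congr_left]
  refine forall_congr' fun i => ?_
  rw [LinearMap.pi_apply_eq_sum_univ]
  simp [mul_comm]

lemma isPolyhedron_simplex {ι : Type*} [Fintype ι] {a : Fin d → ℝ} {p : ι → Fin d → ℝ}
    (hp : LinearIndependent ℝ fun i => p i - a) :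
    IsPolyhedron (convexHull ℝ (insert a (range p))) := by
  obtain ⟨g, hg⟩ := hp.exists_coord
  let L : (Fin d → ℝ) →ₗ[ℝ] Fin d → ℝ :=
    Fintype.linearCombination ℝ (fun i => p i - a) ∘ₗ g - LinearMap.id
  have hL : ∀ x, L x = ∑ i, g x i • (p i - a) - x := fun x => by
    simp [L, Fintype.linearCombination_apply]
  let f : (ι ⊕ Unit) ⊕ (Fin d ⊕ Fin d) → (Fin d → ℝ) →ₗ[ℝ] ℝ :=
    Sum.elim (Sum.elim (fun i => -(LinearMap.proj i ∘ₗ g)) fun _ => ∑ i, LinearMap.proj i ∘ₗ g)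
      (Sum.elim (fun j => LinearMap.proj j ∘ₗ L) fun j => -(LinearMap.proj j ∘ₗ L))
  let b : (ι ⊕ Unit) ⊕ (Fin d ⊕ Fin d) → ℝ :=
    Sum.elim (Sum.elim (fun i => -g a i) fun _ => 1 + ∑ i, g a i)
      (Sum.elim (fun j => L a j) fun j => -L a j)
  convert isPolyhedron_setOf_forall_le f b
  ext x
  rw [mem_convexHull_insert_range_iff]
  simp only [f, b, mem_ofPred_eq, Sum.forall, Sum.elim_inl, Sum.elim_inr, LinearMap.neg_apply,
    LinearMap.comp_apply, LinearMap.proj_apply, LinearMap.sum_apply, neg_le_neg_iff,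
    forall_const]
  constructor
  · rintro ⟨w, hw, hw1, rfl⟩
    have hgx : g (a + ∑ i, w i • (p i - a)) = g a + w := by rw [map_add, hg]
    have hLx : L (a + ∑ i, w i • (p i - a)) = L a := by
      rw [hL, hL, hgx]
      simp only [Pi.add_apply, add_smul, Finset.sum_add_distrib]
      abel
    rw [hLx, hgx]
    refine ⟨⟨fun i => by simpa using hw i, ?_⟩, fun _ => le_rfl, fun _ => le_rfl⟩
    simp only [Pi.add_apply, Finset.sum_add_distrib]
    linarith
  · rintro ⟨⟨h1, h2⟩, h3, h4⟩
    refine ⟨g x - g a, fun i => by simpa using h1 i, ?_, ?_⟩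
    · simp only [Pi.sub_apply, Finset.sum_sub_distrib]
      linarith
    · have h5 : L x = L a := funext fun j => le_antisymm (h3 j) (h4 j)
      rw [hL, hL, sub_eq_sub_iff_add_eq_add] at h5
      simp only [Pi.sub_apply, sub_smul, Finset.sum_sub_distrib]
      rw [add_sub_assoc', eq_sub_iff_add_eq, add_comm a, h5, add_comm]

lemma IsPolyhedron.isClosed {P : Set (Fin d → ℝ)} (hP : IsPolyhedron P) : IsClosed P := by
  obtain ⟨n, A, b, rfl⟩ := hP
  simp only [ofPred_forall]
  exact isClosed_iInter fun i => isClosed_le (by fun_prop) continuous_const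

lemma sLat_subset_intPts (d s : ℕ) : sLat d s ⊆ intPts d := by
  intro x hx i
  obtain ⟨z, hz⟩ := hx i
  exact ⟨s * z, by push_cast; exact hz⟩

lemma isIntegralPoly_convexHull {A : Set (Fin d → ℝ)} (hA : A ⊆ intPts d) :
    IsIntegralPoly (convexHull ℝ A) :=
  (convexHull_mono (subset_inter (subset_convexHull ℝ A) hA)).antisymm
    (convexHull_min inter_subset_left (convex_convexHull ℝ A))

variable {s : ℕ} {a : Fin d → ℝ}

lemma memX_simplex {ι : Type*} [Fintype ι] [Nonempty ι] {p : ι → Fin d → ℝ}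
    (ha : a ∈ intPts d) (hpint : ∀ i, p i ∈ intPts d)
    (hp : LinearIndependent ℝ fun i => p i - a)
    (hne : (intrinsicInterior ℝ (convexHull ℝ (insert a (range p))) ∩ sLat d s).Nonempty) :
    MemX d s a (convexHull ℝ (insert a (range p))) := by
  refine ⟨isPolyhedron_simplex hp, isIntegralPoly_convexHull ?_, ?_, hne⟩
  · rintro _ (rfl | ⟨i, rfl⟩)
    exacts [ha, hpint i]
  · rw [← intrinsicClosure_sdiff_intrinsicInterior]
    refine ⟨subset_intrinsicClosure (subset_convexHull ℝ _ (mem_insert _ _)), fun h => ?_⟩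
    obtain ⟨w, hw, -, h⟩ := (mem_intrinsicInterior_simplex_iff hp).1 h
    have h0 : ∑ i, w i • (p i - a) = ∑ i, (0 : ι → ℝ) i • (p i - a) := by
      rw [left_eq_add] at h
      simp [h]
    obtain ⟨i⟩ := ‹Nonempty ι›
    exact (hw i).ne' (congrFun (eq_of_sum_smul_eq hp h0) i)

/-- Minimality of `P` among the members of `𝒳^d(a)`. -/
def IsMinimalX (d s : ℕ) (a : Fin d → ℝ) (P : Set (Fin d → ℝ)) : Prop :=
  MemX d s a P ∧ ∀ Q : Set (Fin d → ℝ), MemX d s a Q →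
    intrinsicInterior ℝ Q ⊆ intrinsicInterior ℝ P → Q = P

variable {P : Set (Fin d → ℝ)} {c : Fin d → ℝ}

lemma MemX.convex (hP : MemX d s a P) : Convex ℝ P := by
  rw [hP.2.1]
  exact convex_convexHull ℝ _

lemma MemX.apex_mem (hP : MemX d s a P) : a ∈ P :=
  intrinsicFrontier_subset hP.1.isClosed hP.2.2.1

lemma MemX.apex_notMem_intrinsicInterior (hP : MemX d s a P) : a ∉ intrinsicInterior ℝ P := by
  have h := hP.2.2.1
  rw [← intrinsicClosure_sdiff_intrinsicInterior] at h
  exact h.2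

lemma IsMinimalX.exists_simplex (hP : IsMinimalX d s a P) (ha : a ∈ sLat d s)
    (hc : c ∈ intrinsicInterior ℝ P) (hcs : c ∈ sLat d s) {ι : Type*} [Fintype ι]
    (z : ι → Fin d → ℝ) (hz : ∀ i, z i ∈ P ∩ intPts d) (μ : ι → ℝ) (hμ : ∀ i, 0 ≤ μ i)
    (hμ1 : ∑ i, μ i < 1) (hcz : c = a + ∑ i, μ i • (z i - a)) :
    ∃ (n : ℕ) (p : Fin n → Fin d → ℝ), 0 < n ∧ (∀ j, p j ∈ range z) ∧
      LinearIndependent ℝ (fun j => p j - a) ∧ P = convexHull ℝ (insert a (range p)) := by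
  obtain ⟨T, -, ν, hν, hν1, hsum, hli⟩ :=
    exists_linearIndependent_conic_combination (fun i => z i - a) Finset.univ μ fun i _ => hμ i
  let e := T.equivFin.symm
  have hsum1 : ∑ j, ν (e j) = ∑ i ∈ T, ν i := by
    rw [e.sum_comp fun i : T => ν i, Finset.sum_coe_sort T ν]
  have hsum2 : ∑ j, ν (e j) • (z (e j) - a) = ∑ i ∈ T, ν i • (z i - a) := by
    rw [e.sum_comp fun i : T => ν i • (z i - a), Finset.sum_coe_sort T fun i => ν i • (z i - a)]
  have hpli : LinearIndependent ℝ fun j => z (e j) - a := hli.comp e e.injective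
  have hcQ : c ∈ intrinsicInterior ℝ (convexHull ℝ (insert a (range fun j => z (e j)))) := by
    rw [mem_intrinsicInterior_simplex_iff hpli]
    exact ⟨fun j => ν (e j), fun j => hν _ (e j).2, by rw [hsum1]; linarith,
      by rw [hsum2, hsum, hcz]⟩
  have hT : 0 < T.card := by
    rw [Finset.card_pos, Finset.nonempty_iff_ne_empty]
    rintro rfl
    rw [← hsum, Finset.sum_empty, add_zero] at hcz
    exact hP.1.apex_notMem_intrinsicInterior (hcz ▸ hc)
  have : Nonempty (Fin T.card) := ⟨⟨0, hT⟩⟩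
  refine ⟨T.card, fun j => z (e j), hT, fun j => ⟨_, rfl⟩, hpli, (hP.2 _ ?_ ?_).symm⟩
  · exact memX_simplex (sLat_subset_intPts d s ha) (fun j => (hz _).2) hpli ⟨c, hcQ, hcs⟩
  · refine intrinsicInterior_subset_of_subset hP.1.convex (convexHull_min ?_ hP.1.convex) hcQ hc
    rintro _ (rfl | ⟨j, rfl⟩)
    exacts [hP.1.apex_mem, (hz _).1]

lemma IsMinimalX.eq_simplex (hP : IsMinimalX d s a P) (ha : a ∈ sLat d s) :
    ∃ (n : ℕ) (p : Fin n → Fin d → ℝ), 0 < n ∧ (∀ j, p j ∈ intPts d) ∧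
      LinearIndependent ℝ (fun j => p j - a) ∧ P = convexHull ℝ (insert a (range p)) := by
  obtain ⟨c, hc, hcs⟩ := hP.1.2.2.2
  obtain ⟨t, ht, hm⟩ := exists_add_smul_sub_mem_of_mem_intrinsicInterior hc hP.1.apex_mem
  rw [hP.1.2.1, mem_convexHull_iff_exists_fintype] at hm
  obtain ⟨ι, _, w, z, hw, hw1, hz, hsum⟩ := hm
  obtain ⟨n, p, hn, hpz, hli, heq⟩ := hP.exists_simplex ha hc hcs z hz
    (fun i => (1 + t)⁻¹ * w i) (fun i => mul_nonneg (by positivity) (hw i))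
    (by
      rw [← Finset.mul_sum, hw1, mul_one]
      exact inv_lt_one_of_one_lt₀ (by linarith))
    (by
      simp_rw [mul_smul, smul_sub]
      rw [Finset.sum_sub_distrib, ← Finset.smul_sum, ← Finset.smul_sum, ← Finset.sum_smul, hsum,
        hw1]
      match_scalars <;> field_simp
      ring)
  refine ⟨n, p, hn, fun j => ?_, hli, heq⟩
  obtain ⟨i, hi⟩ := hpz j
  exact hi ▸ (hz i).2

/-- Exchanging a vertex of a minimal simplex for an integer point `u` of it is possible only if
`u` is itself a vertex. -/
lemma IsMinimalX.mem_range_of_exchange (hP : IsMinimalX d s a P) (ha : a ∈ sLat d s)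
    (hc : c ∈ intrinsicInterior ℝ P) (hcs : c ∈ sLat d s) {n : ℕ} {p : Fin n → Fin d → ℝ}
    (hpint : ∀ j, p j ∈ intPts d) (hli : LinearIndependent ℝ (fun j => p j - a))
    (heq : P = convexHull ℝ (insert a (range p))) {γ l : Fin n → ℝ} (hγ : ∀ i, 0 < γ i)
    (hcγ : c = a + ∑ i, γ i • (p i - a)) (hl : ∀ i, 0 ≤ l i)
    (hl1 : ∑ i, l i ≤ 1) {u : Fin d → ℝ} (hu : u ∈ intPts d)
    (hul : u = a + ∑ i, l i • (p i - a)) {i₁ : Fin n} (hi₁ : 0 < l i₁)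
    (hlt : γ i₁ * (1 - ∑ i, l i) < (1 - ∑ i, γ i) * l i₁) : u ∈ range p := by
  obtain ⟨i₀, hi₀, hmin⟩ := Finset.exists_min_image (Finset.univ.filter fun i => 0 < l i)
    (fun i => γ i / l i) ⟨i₁, by simpa using hi₁⟩
  simp only [Finset.mem_filter, Finset.mem_univ, true_and] at hi₀ hmin
  set t := γ i₀ / l i₀ with ht
  have ht0 : 0 < t := div_pos (hγ i₀) hi₀
  have hti₀ : γ i₀ - t * l i₀ = 0 := by rw [ht, div_mul_cancel₀ _ hi₀.ne', sub_self]
  have huP : u ∈ P := by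
    rw [heq, mem_convexHull_insert_range_iff]
    exact ⟨l, hl, hl1, hul⟩
  have hpP : ∀ j, p j ∈ P := fun j =>
    heq ▸ subset_convexHull ℝ _ (mem_insert_of_mem _ ⟨j, rfl⟩)
  have hz : ∀ i, Function.update p i₀ u i ∈ P ∩ intPts d := by
    intro i
    by_cases hi : i = i₀
    · rw [hi, Function.update_self]
      exact ⟨huP, hu⟩
    · rw [Function.update_of_ne hi]
      exact ⟨hpP i, hpint i⟩
  obtain ⟨m, q, -, hq, -, hPq⟩ := hP.exists_simplex ha hc hcs (Function.update p i₀ u) hz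
    (fun i => γ i - t * l i + (Pi.single i₀ t : Fin n → ℝ) i)
    (fun i => by
      have hs0 : (0 : Fin n → ℝ) ≤ Pi.single i₀ t := Pi.single_nonneg.2 ht0.le
      refine add_nonneg ?_ (hs0 i)
      rcases (hl i).eq_or_lt with h | h
      · rw [← h]
        simpa using (hγ i).le
      · have := hmin i h
        rw [le_div_iff₀ h] at this
        linarith)
    (by
      have := hmin i₁ hi₁
      rw [le_div_iff₀ hi₁] at this
      simp only [Finset.sum_add_distrib, Finset.sum_sub_distrib, ← Finset.mul_sum,
        Finset.sum_pi_single', Finset.mem_univ, if_true]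
      have h2 : t * l i₁ * (1 - ∑ i, l i) ≤ γ i₁ * (1 - ∑ i, l i) :=
        mul_le_mul_of_nonneg_right this (by linarith)
      nlinarith)
    (by
      have h1 : ∀ i, (γ i - t * l i) • (Function.update p i₀ u i - a) =
          (γ i - t * l i) • (p i - a) := by
        intro i
        by_cases hi : i = i₀
        · rw [hi, hti₀, zero_smul, zero_smul]
        · rw [Function.update_of_ne hi]
      simp_rw [add_smul]
      rw [Finset.sum_add_distrib]
      simp_rw [h1]
      simp only [Pi.single_apply, ite_smul, zero_smul, Finset.sum_ite_eq', Finset.mem_univ,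
        if_true, Function.update_self]
      rw [hul, hcγ]
      simp_rw [sub_smul, mul_smul]
      rw [Finset.sum_sub_distrib, ← Finset.smul_sum]
      simp)
  have hmem : p i₀ ∈ convexHull ℝ (insert a (range (Function.update p i₀ u))) := by
    have h := hpP i₀
    rw [hPq] at h
    exact convexHull_mono (insert_subset_insert (range_subset_iff.2 hq)) h
  obtain ⟨w, hw, hw1, hpw⟩ := mem_convexHull_insert_range_iff.1 hmem
  have hcoord : ∑ i, (Pi.single i₀ 1 : Fin n → ℝ) i • (p i - a) =
      ∑ i, ((if i = i₀ then 0 else w i) + w i₀ * l i) • (p i - a) := by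
    have h1 : ∀ i, w i • (Function.update p i₀ u i - a) =
        (if i = i₀ then (0 : ℝ) else w i) • (p i - a) + if i = i₀ then w i • (u - a) else 0 := by
      intro i
      by_cases hi : i = i₀
      · subst hi
        simp
      · simp [hi]
    rw [← sub_eq_iff_eq_add'] at hpw hul
    simp_rw [h1] at hpw
    simp_rw [add_smul, mul_smul]
    rw [Finset.sum_add_distrib, ← Finset.smul_sum, ← hul]
    rw [Finset.sum_add_distrib] at hpw
    simpa [Pi.single_apply, ite_smul] using hpw
  have hco := congrFun (eq_of_sum_smul_eq hli hcoord) i₀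
  simp only [Pi.single_eq_same, if_true, zero_add] at hco
  have hw₀ : w i₀ ≤ 1 := (Finset.single_le_sum (fun i _ => hw i) (Finset.mem_univ i₀)).trans hw1
  have hl₀ : l i₀ = 1 := by
    have : l i₀ ≤ 1 := (Finset.single_le_sum (fun i _ => hl i) (Finset.mem_univ i₀)).trans hl1
    nlinarith
  have hl' : ∀ i, i ≠ i₀ → l i = 0 := by
    intro i hi
    have h := Finset.add_le_sum (fun i _ => hl i) (Finset.mem_univ i) (Finset.mem_univ i₀) hi
    linarith [hl i]
  refine ⟨i₀, ?_⟩
  rw [hul, Finset.sum_eq_single i₀ (fun i _ hi => by rw [hl' i hi, zero_smul]) (by simp), hl₀]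
  simp

lemma IsMinimalX.sLat_eq_of_mem_intrinsicInterior (hP : IsMinimalX d s a P) (ha : a ∈ sLat d s)
    {n : ℕ} {p : Fin n → Fin d → ℝ} (hpint : ∀ j, p j ∈ intPts d)
    (hli : LinearIndependent ℝ (fun j => p j - a)) (heq : P = convexHull ℝ (insert a (range p)))
    {b : Fin d → ℝ} (hb : b ∈ intrinsicInterior ℝ P ∩ sLat d s)
    (hc : c ∈ intrinsicInterior ℝ P ∩ sLat d s) : b = c := by
  have hvert : ∀ i, p i ∉ intrinsicInterior ℝ P := by
    intro i h
    rw [heq, mem_intrinsicInterior_simplex_iff hli] at h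
    obtain ⟨w, hw, hw1, h⟩ := h
    have hs : ∑ j, (Pi.single i 1 : Fin n → ℝ) j • (p j - a) = ∑ j, w j • (p j - a) := by
      rw [← sub_eq_iff_eq_add'] at h
      simpa [Pi.single_apply, ite_smul] using h
    have h1 := congrFun (eq_of_sum_smul_eq hli hs) i
    rw [Pi.single_eq_same] at h1
    have := Finset.single_le_sum (fun j _ => (hw j).le) (Finset.mem_univ i)
    linarith
  have hb' := hb.1
  have hc' := hc.1
  rw [heq, mem_intrinsicInterior_simplex_iff hli] at hb' hc'
  obtain ⟨β, hβ, hβ1, hbβ⟩ := hb'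
  obtain ⟨γ, hγ, hγ1, hcγ⟩ := hc'
  have h1 : ∀ i, (1 - ∑ i, γ i) * β i ≤ γ i * (1 - ∑ i, β i) := by
    intro i
    by_contra! hlt
    obtain ⟨j, hj⟩ := hP.mem_range_of_exchange ha hc.1 hc.2 hpint hli heq hγ hcγ
      (fun i => (hβ i).le) hβ1.le (sLat_subset_intPts d s hb.2) hbβ (hβ i) hlt
    exact hvert j (hj ▸ hb.1)
  have h2 : ∀ i, (1 - ∑ i, β i) * γ i ≤ β i * (1 - ∑ i, γ i) := by
    intro i
    by_contra! hlt
    obtain ⟨j, hj⟩ := hP.mem_range_of_exchange ha hb.1 hb.2 hpint hli heq hβ hbβ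
      (fun i => (hγ i).le) hγ1.le (sLat_subset_intPts d s hc.2) hcγ (hγ i) hlt
    exact hvert j (hj ▸ hc.1)
  have h3 : ∀ i, (1 - ∑ i, γ i) * β i = (1 - ∑ i, β i) * γ i := fun i => by
    linarith [h1 i, h2 i]
  have h4 : (1 - ∑ i, γ i) * ∑ i, β i = (1 - ∑ i, β i) * ∑ i, γ i := by
    rw [Finset.mul_sum, Finset.mul_sum]
    exact Finset.sum_congr rfl fun i _ => h3 i
  have h5 : ∑ i, β i = ∑ i, γ i := by linarith
  have h6 : ∀ i, β i = γ i := fun i => by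
    have := h3 i
    rw [h5] at this
    exact mul_left_cancel₀ (by linarith) this
  rw [hbβ, hcγ]
  simp_rw [h6]

lemma IsMinimalX.convexHull_range_inter_intPts (hP : IsMinimalX d s a P) (ha : a ∈ sLat d s)
    {n : ℕ} {p : Fin n → Fin d → ℝ} (hpint : ∀ j, p j ∈ intPts d)
    (hli : LinearIndependent ℝ (fun j => p j - a))
    (heq : P = convexHull ℝ (insert a (range p))) :
    convexHull ℝ (range p) ∩ intPts d = range p := by
  refine Subset.antisymm ?_ (subset_inter (subset_convexHull ℝ _) (range_subset_iff.2 hpint))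
  rintro u ⟨hu, huint⟩
  obtain ⟨c, hc, hcs⟩ := hP.1.2.2.2
  have hc' := hc
  rw [heq, mem_intrinsicInterior_simplex_iff hli] at hc'
  obtain ⟨γ, hγ, hγ1, hcγ⟩ := hc'
  obtain ⟨l, hl, hl1, hul⟩ :=
    mem_convexHull_insert_range_iff.1 (convexHull_mono (subset_insert a _) hu)
  obtain ⟨g, hg⟩ := hli.exists_coord
  let φ : (Fin d → ℝ) →ₗ[ℝ] ℝ := ∑ i, LinearMap.proj i ∘ₗ g
  have hφ : ∀ w : Fin n → ℝ, φ (a + ∑ i, w i • (p i - a)) = φ a + ∑ i, w i := by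
    intro w
    rw [map_add]
    simp [φ, -map_sum, hg]
  have hsum : ∑ i, l i = 1 := by
    have h : u ∈ {x | φ x = φ a + 1} := by
      refine convexHull_min ?_ (convex_hyperplane φ.isLinear _) hu
      rintro _ ⟨i, rfl⟩
      have := hφ (Pi.single i 1)
      simpa [Pi.single_apply, ite_smul, -map_add, -map_sum] using this
    rw [mem_ofPred_eq, hul, hφ] at h
    linarith
  obtain ⟨i₁, -, hi₁⟩ : ∃ i ∈ Finset.univ, 0 < l i :=
    Finset.exists_lt_of_sum_lt (f := fun _ => (0 : ℝ)) (by simp [hsum])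
  refine hP.mem_range_of_exchange ha hc hcs hpint hli heq hγ hcγ hl hl1 huint hul hi₁ ?_
  rw [hsum, sub_self, mul_zero]
  exact mul_pos (by linarith) hi₁

end Polyhedron

lemma affineIndependent_cons {E : Type*} [AddCommGroup E] [Module ℝ E] {n : ℕ} {a : E}
    {p : Fin n → E} (hp : LinearIndependent ℝ fun j => p j - a) :
    AffineIndependent ℝ (Fin.cons a p : Fin (n + 1) → E) := by
  rw [affineIndependent_iff_linearIndependent_vsub ℝ _ 0]
  refine (linearIndependent_equiv' (finSuccAboveEquiv 0) ?_).1 hp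
  funext j
  simp [finSuccAboveEquiv_apply]

/-- A minimal element of the poset `(𝒳^d(a), ⪯)` is a simplex having `a` as a vertex,
with exactly one point of `Λ` in its relative interior, and whose facet opposite to `a`
contains no integer points other than its vertices. -/
theorem minimal_elements_of_X (d s : ℕ) (hs : 1 ≤ s) (a : Fin d → ℝ) (ha : a ∈ sLat d s)
    (P : Set (Fin d → ℝ)) (hP : MemX d s a P)
    (hmin : ∀ Q : Set (Fin d → ℝ), MemX d s a Q →
      intrinsicInterior ℝ Q ⊆ intrinsicInterior ℝ P → Q = P) :
    ∃ (k : ℕ), 1 ≤ k ∧ k ≤ d ∧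
      ∃ pts : Fin (k + 1) → (Fin d → ℝ),
        AffineIndependent ℝ pts ∧
        P = convexHull ℝ (Set.range pts) ∧
        pts 0 = a ∧
        (∃ q : Fin d → ℝ, intrinsicInterior ℝ P ∩ sLat d s = {q}) ∧
        convexHull ℝ (pts '' {i | i ≠ 0}) ∩ intPts d = pts '' {i | i ≠ 0} := by
  have hM : IsMinimalX d s a P := ⟨hP, hmin⟩
  obtain ⟨n, p, hn, hpint, hli, heq⟩ := hM.eq_simplex ha
  have hrange : (Fin.cons a p : Fin (n + 1) → Fin d → ℝ) '' {i | i ≠ 0} = range p := by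
    ext x
    simp [Fin.exists_fin_succ]
  refine ⟨n, hn, by simpa using hli.fintype_card_le_finrank, Fin.cons a p,
    affineIndependent_cons hli, by rw [Fin.range_cons, heq], rfl, ?_, ?_⟩
  · obtain ⟨q, hq⟩ := hP.2.2.2
    exact ⟨q, eq_singleton_iff_unique_mem.2 ⟨hq, fun b hb =>
      hM.sLat_eq_of_mem_intrinsicInterior ha hpint hli heq hb hq⟩⟩
  · rw [hrange]
    exact hM.convexHull_range_inter_intPts ha hpint hli heq
end

section
/- Let d, s ∈ ℕ with d ≥ 2, let Λ = s·ℤ^d, and let π : ℝ^d → ℝ^{d−1} denote the projection onto the first d−1 coordinates. If P is a bounded polyhedron belonging to 𝒫_ifm(s,d) (an integral Λ-free polytope, inclusion-maximal among integral Λ-free polyhedra), then int(π(P)) ∩ s·ℤ^{d−1} ≠ ∅, where the interior is taken in ℝ^{d−1}. -/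
open Set

theorem isPolyhedron_of_finite {d : ℕ} {ι : Type} [Finite ι] (A : ι → Fin d → ℝ) (b : ι → ℝ) :
    IsPolyhedron {x | ∀ i, (∑ j, A i j * x j) ≤ b i} := by
  obtain ⟨n, ⟨e⟩⟩ := Finite.exists_equiv_fin ι
  refine ⟨n, fun i => A (e.symm i), fun i => b (e.symm i), ?_⟩
  ext x
  exact ⟨fun h i => h (e.symm i), fun h i => by simpa using h (e i)⟩

theorem IsPolyhedron.convex {d : ℕ} {P : Set (Fin d → ℝ)} (hP : IsPolyhedron P) :
    Convex ℝ P := by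
  obtain ⟨n, A, b, rfl⟩ := hP
  intro x hx y hy u v hu hv huv i
  have hsum : ∑ j, A i j * (u • x + v • y) j
      = u * (∑ j, A i j * x j) + v * ∑ j, A i j * y j := by
    rw [Finset.mul_sum, Finset.mul_sum, ← Finset.sum_add_distrib]
    refine Finset.sum_congr rfl fun j _ => ?_
    simp only [Pi.add_apply, Pi.smul_apply, smul_eq_mul]
    ring
  rw [hsum]
  calc _ ≤ u * b i + v * b i :=
        add_le_add (mul_le_mul_of_nonneg_left (hx i) hu) (mul_le_mul_of_nonneg_left (hy i) hv)
    _ = b i := by rw [← add_mul, huv, one_mul]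

theorem isPolyhedron_singleton_zero (d : ℕ) : IsPolyhedron ({0} : Set (Fin d → ℝ)) := by
  convert isPolyhedron_of_finite (d := d) (ι := Fin d ⊕ Fin d)
    (Sum.elim (fun i => Pi.single i 1) (fun i => Pi.single i (-1))) (fun _ => 0) using 1
  ext x
  simp only [mem_singleton_iff, mem_ofPred_eq, Sum.forall, Sum.elim_inl, Sum.elim_inr,
    Pi.single_apply, ite_mul, zero_mul, one_mul, neg_mul, Finset.sum_ite_eq', Finset.mem_univ,
    if_true, Left.neg_nonpos_iff]
  exact ⟨by rintro rfl; simp, fun h => funext fun i => le_antisymm (h.1 i) (h.2 i)⟩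

/-- Finitely many affine inequalities in one real variable are simultaneously solvable as soon as
the inequalities obtained by eliminating the variable hold. -/
theorem exists_forall_mul_le {ι : Type} [Finite ι] (c r : ι → ℝ)
    (h₀ : ∀ i, c i = 0 → 0 ≤ r i)
    (h : ∀ i j, c i < 0 → 0 < c j → 0 ≤ c j * r i - c i * r j) :
    ∃ t : ℝ, ∀ i, c i * t ≤ r i := by
  have hlu : ∀ a ∈ (fun i => r i / c i) '' {i | c i < 0},
      ∀ b ∈ (fun i => r i / c i) '' {i | 0 < c i}, a ≤ b := by
    rintro _ ⟨i, hi, rfl⟩ _ ⟨j, hj, rfl⟩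
    have hi : c i < 0 := hi
    have hj : 0 < c j := hj
    have := h i j hi hj
    rw [div_le_iff_of_neg hi, div_mul_eq_mul_div, div_le_iff₀ hj]
    linarith
  obtain ⟨t, htl, htu⟩ : ∃ t, t ∈ upperBounds ((fun i => r i / c i) '' {i | c i < 0}) ∧
      t ∈ lowerBounds ((fun i => r i / c i) '' {i | 0 < c i}) := by
    rcases Set.eq_empty_or_nonempty ((fun i => r i / c i) '' {i | c i < 0}) with hL | hL
    · rw [hL, upperBounds_empty]
      obtain ⟨t, ht⟩ := (Set.toFinite ((fun i => r i / c i) '' {i | 0 < c i})).bddBelow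
      exact ⟨t, mem_univ t, ht⟩
    · exact ⟨_, fun a ha => le_csSup (Set.toFinite _).bddAbove ha,
        fun b hb => csSup_le hL fun a ha => hlu a ha b hb⟩
  refine ⟨t, fun i => ?_⟩
  rcases lt_trichotomy (c i) 0 with hi | hi | hi
  · have := htl (mem_image_of_mem _ hi)
    rw [div_le_iff_of_neg hi] at this
    linarith
  · simpa [hi] using h₀ i hi
  · have := htu (mem_image_of_mem _ hi)
    rw [le_div_iff₀ hi] at this
    linarith

/-- Fourier–Motzkin elimination of one coordinate. -/
theorem IsPolyhedron.cylinder {d : ℕ} {P : Set (Fin d → ℝ)} (hP : IsPolyhedron P) (k : Fin d) :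
    IsPolyhedron {x | ∃ t : ℝ, x + t • Pi.single k 1 ∈ P} := by
  obtain ⟨n, A, b, rfl⟩ := hP
  have hshift (i : Fin n) (x : Fin d → ℝ) (t : ℝ) :
      ∑ j, A i j * (x + t • Pi.single k 1 : Fin d → ℝ) j
        = ∑ j, A i j * x j + A i k * t := by
    simp [mul_add, Finset.sum_add_distrib, Pi.single_apply]
  have hcomb (i i' : Fin n) (u v : ℝ) (x : Fin d → ℝ) :
      ∑ j, (u * A i j + v * A i' j) * x j
        = u * ∑ j, A i j * x j + v * ∑ j, A i' j * x j := by
    simp only [Finset.mul_sum, ← Finset.sum_add_distrib, add_mul, mul_assoc]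
  convert isPolyhedron_of_finite (d := d)
    (ι := {i // A i k = 0} ⊕ {p : Fin n × Fin n // A p.1 k < 0 ∧ 0 < A p.2 k})
    (Sum.elim (fun i => A i)
      (fun p j => A p.1.2 k * A p.1.1 j + -A p.1.1 k * A p.1.2 j))
    (Sum.elim (fun i => b i)
      (fun p => A p.1.2 k * b p.1.1 + -A p.1.1 k * b p.1.2)) using 1
  ext x
  simp only [mem_ofPred_eq, hshift, Sum.forall, Sum.elim_inl, Sum.elim_inr, hcomb, Subtype.forall,
    Prod.forall]
  constructor
  · rintro ⟨t, ht⟩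
    refine ⟨fun i hi => by simpa [hi] using ht i, fun i j ⟨hi, hj⟩ => ?_⟩
    have h₁ := mul_le_mul_of_nonneg_left (ht i) hj.le
    have h₂ := mul_le_mul_of_nonneg_left (ht j) (neg_nonneg.2 hi.le)
    linarith
  · rintro ⟨h₀, h⟩
    obtain ⟨t, ht⟩ := exists_forall_mul_le (fun i => A i k)
      (fun i => b i - ∑ j, A i j * x j) (fun i hi => sub_nonneg.2 (h₀ i hi))
      (fun i j hi hj => by have := h i j ⟨hi, hj⟩; linarith)
    exact ⟨t, fun i => by have := ht i; linarith⟩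

open scoped Pointwise in
theorem IsIntegralPoly.cylinder {d : ℕ} {P : Set (Fin d → ℝ)} (hP : IsIntegralPoly P)
    (hpoly : IsPolyhedron P) (k : Fin d) :
    IsIntegralPoly {x | ∃ t : ℝ, x + t • Pi.single k 1 ∈ P} := by
  set e : Fin d → ℝ := Pi.single k 1 with he
  refine subset_antisymm ?_ (convexHull_min inter_subset_left (hpoly.cylinder k).convex)
  rintro x ⟨t, ht⟩
  have hline : ∀ τ : ℝ, τ • e ∈ convexHull ℝ (range fun z : ℤ => (z : ℝ) • e) := fun τ => by
    refine segment_subset_convexHull (mem_range_self ⌊τ⌋) (mem_range_self (⌊τ⌋ + 1))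
      ⟨1 - Int.fract τ, Int.fract τ, by linarith [Int.fract_lt_one τ], Int.fract_nonneg τ,
        by ring, ?_⟩
    rw [smul_smul, smul_smul, ← add_smul]
    congr 1
    push_cast
    linarith [Int.floor_add_fract τ]
  have hx : x ∈ convexHull ℝ (P ∩ intPts d + range fun z : ℤ => (z : ℝ) • e) := by
    rw [convexHull_add]
    exact ⟨x + t • e, hP ▸ ht, (-t) • e, hline _, by simp⟩
  refine convexHull_mono ?_ hx
  rintro _ ⟨y, ⟨hyP, hy⟩, _, ⟨z, rfl⟩, rfl⟩
  refine ⟨⟨-z, by simpa using hyP⟩, fun i => ?_⟩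
  obtain ⟨w, hw⟩ := hy i
  exact ⟨w + z * (Pi.single k 1 : Fin d → ℤ) i, by simp [he, hw, Pi.single_apply]⟩

theorem MemPifm.nonempty {d s : ℕ} (hd : d ≠ 0) {P : Set (Fin d → ℝ)} (hP : MemPifm d s P) :
    P.Nonempty := by
  rw [nonempty_iff_ne_empty]
  rintro rfl
  have : Nonempty (Fin d) := ⟨⟨0, Nat.pos_of_ne_zero hd⟩⟩
  refine (singleton_ne_empty (0 : Fin d → ℝ)) (hP.2 {0} ⟨isPolyhedron_singleton_zero d, ?_, ?_⟩
    (empty_subset _)).symm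
  · have h0 : (0 : Fin d → ℝ) ∈ intPts d := fun i => ⟨0, by simp⟩
    rw [IsIntegralPoly, inter_eq_left.2 (singleton_subset_iff.2 h0), convexHull_singleton]
  · rw [interior_singleton, empty_inter]

/-- The projection of a bounded element of `𝒫_ifm(s,d)` onto the first `d-1` coordinates
contains a point of `s·ℤ^{d-1}` in its interior. -/
theorem Pifm_projection_not_free (d s : ℕ) (hs : 1 ≤ s) (hd : 2 ≤ d)
    (P : Set (Fin d → ℝ)) (hP : MemPifm d s P) (hbd : Bornology.IsBounded P) :
    (interior ((fun (x : Fin d → ℝ) (i : Fin (d - 1)) => x (Fin.castLE (Nat.sub_le d 1) i)) '' P)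
      ∩ sLat (d - 1) s).Nonempty := by
  by_contra hempty
  let k : Fin d := ⟨d - 1, by omega⟩
  let π : (Fin d → ℝ) →ₗ[ℝ] (Fin (d - 1) → ℝ) :=
    LinearMap.funLeft ℝ ℝ (Fin.castLE (Nat.sub_le d 1))
  have hπ : IsOpenMap π := π.isOpenMap_of_finiteDimensional
    (LinearMap.funLeft_surjective_of_injective _ _ _ (Fin.castLE_injective _))
  have hπk : π (Pi.single k 1) = 0 := by
    ext i
    have : Fin.castLE (Nat.sub_le d 1) i ≠ k := fun h => by
      have hval : (i : ℕ) = d - 1 := congrArg Fin.val h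
      omega
    simp [π, LinearMap.funLeft_apply, this]
  let Q : Set (Fin d → ℝ) := {x | ∃ t : ℝ, x + t • Pi.single k 1 ∈ P}
  have hPQ : P = Q := by
    refine hP.2 Q ⟨hP.1.1.cylinder k, hP.1.2.1.cylinder hP.1.1 k, ?_⟩
      fun x hx => ⟨0, by simpa using hx⟩
    rw [eq_empty_iff_forall_notMem]
    rintro x ⟨hxQ, hxs⟩
    refine hempty ⟨π x, ?_, fun i => hxs _⟩
    refine interior_maximal ?_ (hπ _ isOpen_interior) (mem_image_of_mem π hxQ)
    rintro _ ⟨y, hy, rfl⟩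
    obtain ⟨t, ht⟩ := interior_subset hy
    refine ⟨y + t • Pi.single k 1, ht, ?_⟩
    change π (y + t • Pi.single k 1) = π y
    rw [map_add, map_smul, hπk, smul_zero, add_zero]
  obtain ⟨x, hx⟩ := hP.nonempty (by omega)
  obtain ⟨C, hC⟩ := hbd.exists_norm_le
  have hmem : x + (C + 1 - x k) • Pi.single k 1 ∈ P := by
    rw [hPQ]
    exact ⟨-(C + 1 - x k), by simpa [add_assoc, ← add_smul] using hx⟩
  have hle := (le_abs_self _).trans ((norm_le_pi_norm _ k).trans (hC _ hmem))
  simp only [Pi.add_apply, Pi.smul_apply, Pi.single_eq_same, smul_eq_mul, mul_one] at hle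
  linarith
end

section
/- Every maximal lattice-free integral polytope P ⊆ ℝ³ (i.e., P ∈ 𝓜³) has at most six facets. Moreover, if P ∈ 𝓜³ has exactly six facets, then each facet of P contains exactly one integer point in its relative interior. -/
open Set

/-- Membership in `𝓜³`: a maximal lattice-free integral polytope in `ℝ³`, i.e. a bounded
integral polyhedron with nonempty interior, whose interior contains no integer point, and
which is not properly contained in any convex set whose interior contains no integer point. -/
def MemM3 (P : Set (Fin 3 → ℝ)) : Prop :=
  IsPolyhedron P ∧ Bornology.IsBounded P ∧ IsIntegralPoly P ∧ (interior P).Nonempty ∧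
    interior P ∩ intPts 3 = ∅ ∧
    ∀ K : Set (Fin 3 → ℝ), Convex ℝ K → interior K ∩ intPts 3 = ∅ → P ⊆ K → P = K

/-- A facet of a three-dimensional polytope `P`: a two-dimensional face, i.e. a nonempty
convex extreme subset whose affine hull is two-dimensional. -/
def IsFacet (P F : Set (Fin 3 → ℝ)) : Prop :=
  IsExtreme ℝ P F ∧ Convex ℝ F ∧ Module.finrank ℝ (vectorSpan ℝ F) = 2

/-- The integer vector `z` seen as a point of `ℝ³`. -/
def latticePt (z : Fin 3 → ℤ) : Fin 3 → ℝ := fun i => (z i : ℝ)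

/-- The polyhedron `{x | ∀ i, A i ⬝ᵥ x ≤ b i}`. -/
def halfspaces {ι : Type*} (A : ι → Fin 3 → ℝ) (b : ι → ℝ) : Set (Fin 3 → ℝ) :=
  {x | ∀ i, A i ⬝ᵥ x ≤ b i}

/-- Constraint `i` is tight at `x` and all the other constraints are strict at `x`. -/
def OnlyTight {ι : Type*} (A : ι → Fin 3 → ℝ) (b : ι → ℝ) (i : ι) (x : Fin 3 → ℝ) : Prop :=
  A i ⬝ᵥ x = b i ∧ ∀ j, j ≠ i → A j ⬝ᵥ x < b j

lemma latticePt_injective : Function.Injective latticePt := by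
  intro z w h
  ext i
  have := congrFun h i
  simpa [latticePt] using this

lemma range_latticePt : range latticePt = intPts 3 := by
  ext x
  constructor
  · rintro ⟨z, rfl⟩ i
    exact ⟨z i, rfl⟩
  · intro h
    choose z hz using h
    exact ⟨z, funext fun i => (hz i).symm⟩

/-- The residue class modulo two of an integer vector. -/
def parity (z : Fin 3 → ℤ) : Fin 3 → ZMod 2 := fun i => (z i : ZMod 2)

lemma exists_lattice_midpoint {z w : Fin 3 → ℤ} (h : parity z = parity w) :
    ∃ m : Fin 3 → ℤ, latticePt m = (1 / 2 : ℝ) • (latticePt z + latticePt w) := by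
  have : ∀ i, ∃ k : ℤ, w i - z i = 2 * k := fun i =>
    (ZMod.intCast_eq_intCast_iff_dvd_sub (z i) (w i) 2).1 (congrFun h i)
  choose k hk using this
  refine ⟨fun i => z i + k i, funext fun i => ?_⟩
  have h2 : (w i : ℝ) - z i = 2 * k i := by exact_mod_cast hk i
  simp only [latticePt, Pi.smul_apply, Pi.add_apply, smul_eq_mul, Int.cast_add]
  linarith

lemma dotProduct_half_add (a x y : Fin 3 → ℝ) :
    a ⬝ᵥ ((1 / 2 : ℝ) • (x + y)) = (a ⬝ᵥ x + a ⬝ᵥ y) / 2 := by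
  rw [dotProduct_smul, dotProduct_add, smul_eq_mul]
  ring

lemma finite_lattice_of_isBounded {s : Set (Fin 3 → ℝ)} (hs : Bornology.IsBounded s) :
    {z : Fin 3 → ℤ | latticePt z ∈ s}.Finite := by
  obtain ⟨M, hM⟩ := hs.exists_norm_le
  refine (Set.finite_Icc (fun _ : Fin 3 => -⌈M⌉) (fun _ => ⌈M⌉)).subset fun z hz => ?_
  have h : ∀ i, |(z i : ℝ)| ≤ M := fun i => (norm_le_pi_norm (latticePt z) i).trans (hM _ hz)
  constructor <;> intro i
  · have h1 := (abs_le.1 (h i)).1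
    have h2 := Int.le_ceil M
    have : (-(⌈M⌉ : ℝ)) ≤ z i := by linarith
    exact_mod_cast this
  · have h1 := (abs_le.1 (h i)).2
    have h2 := Int.le_ceil M
    have : (z i : ℝ) ≤ ⌈M⌉ := by linarith
    exact_mod_cast this

section Polyhedra

variable {ι : Type*} {A : ι → Fin 3 → ℝ} {b : ι → ℝ}

lemma convex_halfspaces : Convex ℝ (halfspaces A b) := by
  intro x hx y hy s t hs ht hst i
  rw [dotProduct_add, dotProduct_smul, dotProduct_smul, smul_eq_mul, smul_eq_mul]
  calc s * (A i ⬝ᵥ x) + t * (A i ⬝ᵥ y) ≤ s * b i + t * b i :=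
        add_le_add (mul_le_mul_of_nonneg_left (hx i) hs) (mul_le_mul_of_nonneg_left (hy i) ht)
    _ = b i := by rw [← add_mul, hst, one_mul]

lemma continuous_dotProduct_left (a : Fin 3 → ℝ) : Continuous fun x : Fin 3 → ℝ => a ⬝ᵥ x := by
  unfold dotProduct
  fun_prop

lemma isClosed_halfspaces : IsClosed (halfspaces A b) := by
  have : halfspaces A b = ⋂ i, {x | A i ⬝ᵥ x ≤ b i} := by
    ext x
    simp [halfspaces]
  rw [this]
  exact isClosed_iInter fun i => isClosed_le (continuous_dotProduct_left _) continuous_const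

lemma OnlyTight.mem {i : ι} {x : Fin 3 → ℝ} (h : OnlyTight A b i x) : x ∈ halfspaces A b := by
  intro j
  by_cases hj : j = i
  · subst hj
    exact h.1.le
  · exact (h.2 j hj).le

/-- Strict inequalities at `x` persist along short segments through `x`. -/
lemma exists_pos_strict [Finite ι] (x v : Fin 3 → ℝ) :
    ∃ ε > 0, ∀ s : ℝ, |s| ≤ ε → ∀ j, A j ⬝ᵥ x < b j → A j ⬝ᵥ (x + s • v) < b j := by
  have h : ∀ᶠ s in nhds (0 : ℝ), ∀ j, A j ⬝ᵥ x < b j → A j ⬝ᵥ (x + s • v) < b j := by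
    rw [Filter.eventually_all]
    intro j
    by_cases hj : A j ⬝ᵥ x < b j
    · have hc : Continuous fun s : ℝ => A j ⬝ᵥ (x + s • v) :=
        (continuous_dotProduct_left _).comp (by fun_prop)
      have := (hc.tendsto 0).eventually_lt_const (u := b j) (by simpa using hj)
      filter_upwards [this] with s hs _ using hs
    · exact Filter.Eventually.of_forall fun s h => absurd h hj
  obtain ⟨ε, hε, H⟩ := Metric.eventually_nhds_iff.1 h
  refine ⟨ε / 2, half_pos hε, fun s hs => H ?_⟩
  rw [Real.dist_eq, sub_zero]
  linarith

lemma mem_interior_halfspaces [Finite ι] {x : Fin 3 → ℝ} (hx : ∀ j, A j ⬝ᵥ x < b j) :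
    x ∈ interior (halfspaces A b) := by
  have ho : IsOpen (⋂ i, {y | A i ⬝ᵥ y < b i}) :=
    isOpen_iInter_of_finite fun i => isOpen_lt (continuous_dotProduct_left _) continuous_const
  refine mem_interior.2 ⟨_, fun y hy i => ?_, ho, mem_iInter.2 hx⟩
  exact (mem_iInter.1 hy i).le

lemma dotProduct_self_pos {a : Fin 3 → ℝ} (ha : a ≠ 0) : 0 < a ⬝ᵥ a := by
  have h0 : 0 ≤ a ⬝ᵥ a := by
    rw [dotProduct]
    exact Finset.sum_nonneg fun i _ => mul_self_nonneg _
  exact lt_of_le_of_ne h0 fun h => ha (dotProduct_self_eq_zero.1 h.symm)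

/-- A non-constant affine inequality valid on a set is strict in its interior. -/
lemma dotProduct_lt_of_mem_interior {s : Set (Fin 3 → ℝ)} {a : Fin 3 → ℝ} {β : ℝ} (ha : a ≠ 0)
    (hs : ∀ y ∈ s, a ⬝ᵥ y ≤ β) {x : Fin 3 → ℝ} (hx : x ∈ interior s) : a ⬝ᵥ x < β := by
  have hc : Continuous fun t : ℝ => x + t • a := by fun_prop
  have h1 : ∀ᶠ t in nhds (0 : ℝ), x + t • a ∈ s :=
    (hc.tendsto 0).eventually (by simpa using mem_interior_iff_mem_nhds.1 hx)
  obtain ⟨ε, hε, H⟩ := Metric.eventually_nhds_iff.1 h1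
  have h2 := hs _ (H (y := ε / 2) (by
    rw [Real.dist_eq, sub_zero, abs_of_pos (half_pos hε)]
    linarith))
  rw [dotProduct_add, dotProduct_smul, smul_eq_mul] at h2
  have := mul_pos (half_pos hε) (dotProduct_self_pos ha)
  linarith

/-- An irredundant constraint is the only tight one at some point. -/
lemma exists_onlyTight {o z : Fin 3 → ℝ} {i : ι} (ho : ∀ j, A j ⬝ᵥ o < b j)
    (hz : ∀ j, j ≠ i → A j ⬝ᵥ z ≤ b j) (hzi : b i < A i ⬝ᵥ z) : ∃ q, OnlyTight A b i q := by
  have hd : 0 < A i ⬝ᵥ z - A i ⬝ᵥ o := by linarith [ho i]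
  set s := (b i - A i ⬝ᵥ o) / (A i ⬝ᵥ z - A i ⬝ᵥ o) with hs
  have hs0 : 0 < s := div_pos (by linarith [ho i]) hd
  have hs1 : s < 1 := by
    rw [hs, div_lt_one hd]
    linarith
  have key : ∀ j, A j ⬝ᵥ ((1 - s) • o + s • z) = (1 - s) * (A j ⬝ᵥ o) + s * (A j ⬝ᵥ z) := by
    intro j
    rw [dotProduct_add, dotProduct_smul, dotProduct_smul, smul_eq_mul, smul_eq_mul]
  refine ⟨(1 - s) • o + s • z, ?_, fun j hj => ?_⟩
  · have : s * (A i ⬝ᵥ z - A i ⬝ᵥ o) = b i - A i ⬝ᵥ o := div_mul_cancel₀ _ hd.ne'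
    rw [key]
    linarith
  · rw [key]
    have h1 := mul_lt_mul_of_pos_left (ho j) (sub_pos.2 hs1)
    have h2 := mul_le_mul_of_nonneg_left (hz j hj) hs0.le
    linarith

/-- **Lovász**: in a maximal lattice-free polytope every facet has a lattice point in its
relative interior. -/
lemma exists_lattice_onlyTight [Finite ι] (hbd : Bornology.IsBounded (halfspaces A b))
    (hA : ∀ i, A i ≠ 0) (hfree : ∀ z, ¬ ∀ j, A j ⬝ᵥ latticePt z < b j)
    (hmax : ∀ K : Set (Fin 3 → ℝ), Convex ℝ K → interior K ∩ intPts 3 = ∅ →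
      halfspaces A b ⊆ K → halfspaces A b = K)
    {i : ι} {q : Fin 3 → ℝ} (hq : OnlyTight A b i q) : ∃ z, OnlyTight A b i (latticePt z) := by
  by_contra! hno
  obtain ⟨M, hM⟩ := hbd.exists_norm_le
  have hfin := finite_lattice_of_isBounded (Metric.isBounded_closedBall (x := (0 : Fin 3 → ℝ))
    (r := M + 1))
  obtain ⟨ε, hε, hεz⟩ : ∃ ε > 0, ∀ z : Fin 3 → ℤ, latticePt z ∈ Metric.closedBall 0 (M + 1) →
      b i < A i ⬝ᵥ latticePt z → b i + ε ≤ A i ⬝ᵥ latticePt z := by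
    have hfin' := hfin.inter_of_left {z | b i < A i ⬝ᵥ latticePt z}
    rcases Set.eq_empty_or_nonempty
      ({z : Fin 3 → ℤ | latticePt z ∈ Metric.closedBall 0 (M + 1)} ∩
        {z | b i < A i ⬝ᵥ latticePt z}) with h | h
    · refine ⟨1, one_pos, fun z h1 h2 => ?_⟩
      exact (h.subset ⟨h1, h2⟩).elim
    · obtain ⟨z₀, hz₀, hmin⟩ := Set.exists_min_image _ (fun z => A i ⬝ᵥ latticePt z) hfin' h
      refine ⟨A i ⬝ᵥ latticePt z₀ - b i, sub_pos.2 hz₀.2, fun z h1 h2 => ?_⟩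
      have := hmin z ⟨h1, h2⟩
      linarith
  classical
  set b' : ι → ℝ := Function.update b i (b i + ε) with hb'
  have hb'i : b' i = b i + ε := by simp [hb']
  have hb'j : ∀ j, j ≠ i → b' j = b j := fun j hj => by simp [hb', hj]
  set K := halfspaces A b' ∩ Metric.closedBall (0 : Fin 3 → ℝ) (M + 1) with hK
  have hsub : halfspaces A b ⊆ K := by
    intro x hx
    refine ⟨fun j => ?_, ?_⟩
    · by_cases hj : j = i
      · subst hj
        rw [hb'i]
        linarith [hx j]
      · rw [hb'j j hj]
        exact hx j
    · rw [mem_closedBall_zero_iff]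
      linarith [hM x hx]
  have hKfree : interior K ∩ intPts 3 = ∅ := by
    rw [Set.eq_empty_iff_forall_notMem]
    rintro x ⟨hx, hxZ⟩
    rw [← range_latticePt] at hxZ
    obtain ⟨z, rfl⟩ := hxZ
    have hlt : ∀ j, A j ⬝ᵥ latticePt z < b' j := fun j =>
      dotProduct_lt_of_mem_interior (hA j) (fun y hy => hy.1 j) hx
    have hzi : A i ⬝ᵥ latticePt z ≤ b i := by
      by_contra! h
      have h1 := hεz z (interior_subset hx).2 h
      have h2 := hlt i
      rw [hb'i] at h2
      linarith
    have hzj : ∀ j, j ≠ i → A j ⬝ᵥ latticePt z < b j := fun j hj => by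
      have := hlt j
      rwa [hb'j j hj] at this
    rcases hzi.lt_or_eq with h | h
    · refine hfree z fun j => ?_
      by_cases hj : j = i
      · exact hj ▸ h
      · exact hzj j hj
    · exact hno z ⟨h, hzj⟩
  have hPK := hmax K (convex_halfspaces.inter (convex_closedBall _ _)) hKfree hsub
  obtain ⟨δ₁, hδ₁, H⟩ := exists_pos_strict (A := A) (b := b') q (A i)
  set δ₂ := 1 / (‖A i‖ + 1) with hδ₂
  have hden : 0 < ‖A i‖ + 1 := by positivity
  have hδ₂0 : 0 < δ₂ := by positivity
  set δ := min δ₁ δ₂ with hδ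
  have hδ0 : 0 < δ := lt_min hδ₁ hδ₂0
  have hmem : q + δ • A i ∈ K := by
    refine ⟨fun j => (H δ ?_ j ?_).le, ?_⟩
    · rw [abs_of_pos hδ0]
      exact min_le_left _ _
    · by_cases hj : j = i
      · rw [hj, hb'i, hq.1]
        linarith
      · rw [hb'j j hj]
        exact hq.2 j hj
    · rw [mem_closedBall_zero_iff]
      refine (norm_add_le _ _).trans (add_le_add (hM q hq.mem) ?_)
      rw [norm_smul, Real.norm_of_nonneg hδ0.le]
      calc δ * ‖A i‖ ≤ δ₂ * (‖A i‖ + 1) :=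
            mul_le_mul (min_le_right _ _) (by linarith) (norm_nonneg _) hδ₂0.le
        _ = 1 := by rw [hδ₂]; field_simp
  rw [← hPK] at hmem
  have h1 := hmem i
  rw [dotProduct_add, dotProduct_smul, smul_eq_mul, hq.1] at h1
  have := mul_pos hδ0 (dotProduct_self_pos (hA i))
  linarith

/-- Two points of the polyhedron for which there are two constraints tight at both of them. -/
def ShareTwo (A : ι → Fin 3 → ℝ) (b : ι → ℝ) (x y : Fin 3 → ℝ) : Prop :=
  ∃ j k, j ≠ k ∧ A j ⬝ᵥ x = b j ∧ A j ⬝ᵥ y = b j ∧ A k ⬝ᵥ x = b k ∧ A k ⬝ᵥ y = b k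

/-- At an extreme point of a plane section at least two constraints are tight. -/
lemma exists_two_tight_of_extreme [Finite ι] {c : Fin 3 → ℝ} {γ : ℝ} {r : Fin 3 → ℝ} (i : ι)
    (hr : r ∈ (halfspaces A b ∩ {x | c ⬝ᵥ x = γ}).extremePoints ℝ) :
    ∃ j k, j ≠ k ∧ A j ⬝ᵥ r = b j ∧ A k ⬝ᵥ r = b k := by
  by_contra! hcon
  obtain ⟨k, hk⟩ : ∃ k, ∀ j, j ≠ k → A j ⬝ᵥ r < b j := by
    by_cases h : ∃ k, A k ⬝ᵥ r = b k
    · obtain ⟨k, hk⟩ := h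
      exact ⟨k, fun j hj => lt_of_le_of_ne (hr.1.1 j) fun h => hcon j k hj h hk⟩
    · push Not at h
      exact ⟨i, fun j _ => lt_of_le_of_ne (hr.1.1 j) (h j)⟩
  obtain ⟨v, hv0, hv⟩ := Matrix.exists_mulVec_eq_zero_iff.2
    (show (Matrix.of ![A k, c, c]).det = 0 from
      Matrix.det_zero_of_row_eq (i := 1) (j := 2) (by decide) (by rfl))
  have hvk : A k ⬝ᵥ v = 0 := congrFun hv 0
  have hvc : c ⬝ᵥ v = 0 := congrFun hv 1
  obtain ⟨ε, hε, H⟩ := exists_pos_strict (A := A) (b := b) r v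
  have hmem : ∀ s : ℝ, |s| ≤ ε → r + s • v ∈ halfspaces A b ∩ {x | c ⬝ᵥ x = γ} := by
    refine fun s hs => ⟨fun j => ?_, ?_⟩
    · by_cases hj : j = k
      · subst hj
        rw [dotProduct_add, dotProduct_smul, hvk, smul_zero, add_zero]
        exact hr.1.1 j
      · exact (H s hs j (hk j hj)).le
    · have := hr.1.2
      simp only [mem_ofPred_eq] at this ⊢
      rw [dotProduct_add, dotProduct_smul, hvc, smul_zero, add_zero, this]
  have h1 := (mem_extremePoints.1 hr).2 _ (hmem ε (abs_of_pos hε).le) _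
    (hmem (-ε) (by rw [abs_neg, abs_of_pos hε]))
    ⟨1 / 2, 1 / 2, by norm_num, by norm_num, by norm_num, by module⟩
  have h2 : ε • v = 0 := by simpa using h1.1
  rcases smul_eq_zero.1 h2 with h | h
  · exact hε.ne' h
  · exact hv0 h

/-- A lattice point off the facet `i` and a second lattice point, off a given line of that
facet, which lie on a common edge. -/
lemma exists_shareTwo [Finite ι] (hbd : Bornology.IsBounded (halfspaces A b))
    (hintegral : IsIntegralPoly (halfspaces A b)) {i : ι} (hA : A i ≠ 0) {p u : Fin 3 → ℝ}
    (hp : OnlyTight A b i p) (hu : u ≠ 0) (hiu : A i ⬝ᵥ u = 0) :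
    ∃ w x : Fin 3 → ℤ, latticePt w ∈ halfspaces A b ∧ latticePt x ∈ halfspaces A b ∧ w ≠ x ∧
      A i ⬝ᵥ latticePt w < b i ∧
      (A i ⬝ᵥ latticePt x < b i ∨ crossProduct u (latticePt x - p) ≠ 0) ∧
      ShareTwo A b (latticePt w) (latticePt x) := by
  set e := crossProduct (A i) u with he
  have hee : 0 < e ⬝ᵥ e := by
    rw [he, cross_dot_cross, hiu, zero_mul, sub_zero]
    exact mul_pos (dotProduct_self_pos hA) (dotProduct_self_pos hu)
  have hie : A i ⬝ᵥ e = 0 := dot_self_cross _ _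
  have hei : e ⬝ᵥ A i = 0 := by rw [dotProduct_comm, hie]
  -- a plane through the line that avoids all lattice points off the facet
  obtain ⟨t, ht⟩ := ((finite_lattice_of_isBounded hbd).image
    fun w => e ⬝ᵥ (latticePt w - p) / (A i ⬝ᵥ (latticePt w - p))).exists_notMem
  set c := e - t • A i with hc
  have hcdot : ∀ x, c ⬝ᵥ x = e ⬝ᵥ x - t * (A i ⬝ᵥ x) := fun x => by
    rw [hc, sub_dotProduct, smul_dotProduct, smul_eq_mul]
  have havoid : ∀ w : Fin 3 → ℤ, latticePt w ∈ halfspaces A b → A i ⬝ᵥ latticePt w < b i →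
      c ⬝ᵥ (latticePt w - p) ≠ 0 := by
    intro w hw hwi h0
    refine ht ⟨w, hw, ?_⟩
    have hne : A i ⬝ᵥ (latticePt w - p) ≠ 0 := by
      rw [dotProduct_sub, hp.1]
      linarith
    rw [hcdot] at h0
    rw [div_eq_iff hne]
    linarith
  set S := halfspaces A b ∩ {x | c ⬝ᵥ x = c ⬝ᵥ p} with hS
  have hScomp : IsCompact S := by
    refine Metric.isCompact_of_isClosed_isBounded
      (isClosed_halfspaces.inter (isClosed_eq (continuous_dotProduct_left _) continuous_const)) ?_
    exact hbd.subset inter_subset_left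
  have hSconv : Convex ℝ S := by
    refine convex_halfspaces.inter fun x hx y hy s t _ _ hst => ?_
    simp only [mem_ofPred_eq] at hx hy ⊢
    rw [dotProduct_add, dotProduct_smul, dotProduct_smul, hx, hy, ← add_smul, hst, one_smul]
  obtain ⟨r, hr, hri⟩ : ∃ r ∈ S.extremePoints ℝ, A i ⬝ᵥ r < b i := by
    by_contra! hcon
    have hsub : S ⊆ {x | b i ≤ A i ⬝ᵥ x} := by
      rw [← closure_convexHull_extremePoints hScomp hSconv]
      refine closure_minimal (convexHull_min hcon ?_)
        (isClosed_le continuous_const (continuous_dotProduct_left _))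
      intro x hx y hy s t hs ht hst
      simp only [mem_ofPred_eq] at hx hy ⊢
      rw [dotProduct_add, dotProduct_smul, dotProduct_smul, smul_eq_mul, smul_eq_mul]
      calc b i = s * b i + t * b i := by rw [← add_mul, hst, one_mul]
        _ ≤ _ := add_le_add (mul_le_mul_of_nonneg_left hx hs) (mul_le_mul_of_nonneg_left hy ht)
    set d := A i + (t * (A i ⬝ᵥ A i) / (e ⬝ᵥ e)) • e with hd
    have hid : A i ⬝ᵥ d = A i ⬝ᵥ A i := by
      rw [hd, dotProduct_add, dotProduct_smul, hie, smul_zero, add_zero]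
    have hcd : c ⬝ᵥ d = 0 := by
      rw [hcdot, hid, hd, dotProduct_add, dotProduct_smul, hei, smul_eq_mul, zero_add,
        div_mul_cancel₀ _ hee.ne', sub_self]
    obtain ⟨ε, hε, H⟩ := exists_pos_strict (A := A) (b := b) p d
    have hlt : A i ⬝ᵥ (p + (-ε) • d) < b i := by
      rw [dotProduct_add, dotProduct_smul, hid, smul_eq_mul, hp.1]
      have := mul_pos hε (dotProduct_self_pos hA)
      linarith
    have hmem : p + (-ε) • d ∈ S := by
      refine ⟨fun j => ?_, ?_⟩
      · by_cases hj : j = i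
        · rw [hj]
          exact hlt.le
        · exact (H (-ε) (by rw [abs_neg, abs_of_pos hε]) j (hp.2 j hj)).le
      · simp only [mem_ofPred_eq]
        rw [dotProduct_add, dotProduct_smul, hcd, smul_zero, add_zero]
    exact absurd (hsub hmem) (not_le.2 hlt)
  obtain ⟨j, k, hjk, hj, hk⟩ := exists_two_tight_of_extreme i hr
  have hrhull := hr.1.1
  rw [hintegral, mem_convexHull_iff_exists_fintype] at hrhull
  obtain ⟨κ, _, m, z, hm0, hm1, hz, hzr⟩ := hrhull
  have hsum : ∀ a : Fin 3 → ℝ, a ⬝ᵥ r = ∑ l, m l * (a ⬝ᵥ z l) := by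
    intro a
    rw [← hzr, dotProduct_sum]
    simp only [dotProduct_smul, smul_eq_mul]
  have htight : ∀ l, A l ⬝ᵥ r = b l → ∀ n, 0 < m n → A l ⬝ᵥ z n = b l := by
    intro l hl n hn
    have h0 : ∑ n, m n * (b l - A l ⬝ᵥ z n) = 0 := by
      simp only [mul_sub, Finset.sum_sub_distrib, ← Finset.sum_mul, hm1, ← hsum, hl]
      ring
    have := (Finset.sum_eq_zero_iff_of_nonneg fun n _ =>
      mul_nonneg (hm0 n) (sub_nonneg.2 ((hz n).1 l))).1 h0 n (Finset.mem_univ n)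
    rcases mul_eq_zero.1 this with h | h
    · exact absurd h hn.ne'
    · linarith
  obtain ⟨n₀, hn₀, hn₀i⟩ : ∃ n, 0 < m n ∧ A i ⬝ᵥ z n < b i := by
    by_contra! hcon
    have : b i ≤ A i ⬝ᵥ r := by
      rw [hsum]
      calc b i = ∑ n, m n * b i := by rw [← Finset.sum_mul, hm1, one_mul]
        _ ≤ _ := Finset.sum_le_sum fun n _ => by
          rcases (hm0 n).eq_or_lt with h | h
          · rw [← h, zero_mul, zero_mul]
          · exact mul_le_mul_of_nonneg_left (hcon n h) (hm0 n)
    linarith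
  obtain ⟨w, hw⟩ : ∃ w, latticePt w = z n₀ := by
    have := (hz n₀).2
    rwa [← range_latticePt] at this
  by_contra! hcon
  have hother : ∀ n, 0 < m n → z n ≠ z n₀ → c ⬝ᵥ (z n - p) = 0 := by
    intro n hn hne
    obtain ⟨x, hx⟩ : ∃ x, latticePt x = z n := by
      have := (hz n).2
      rwa [← range_latticePt] at this
    have hnot := hcon w x (hw ▸ (hz n₀).1) (hx ▸ (hz n).1)
      (fun h => hne (by rw [← hx, ← hw, h])) (hw ▸ hn₀i)
    have hshare : ShareTwo A b (latticePt w) (latticePt x) := by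
      rw [hw, hx]
      exact ⟨j, k, hjk, htight j hj _ hn₀, htight j hj _ hn, htight k hk _ hn₀, htight k hk _ hn⟩
    have hxi : b i ≤ A i ⬝ᵥ z n := by
      by_contra! h
      exact hnot (Or.inl (hx ▸ h)) hshare
    have hcross : crossProduct u (z n - p) = 0 := by
      by_contra h
      exact hnot (Or.inr (by rwa [hx])) hshare
    have hi0 : A i ⬝ᵥ (z n - p) = 0 := by
      rw [dotProduct_sub, hp.1, le_antisymm ((hz n).1 i) hxi, sub_self]
    have he0 : e ⬝ᵥ (z n - p) = 0 := by
      rw [he, dotProduct_comm, triple_product_permutation, hcross, dotProduct_zero]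
    rw [hcdot, hi0, he0, mul_zero, sub_zero]
  have hzero : ∑ n, m n * (c ⬝ᵥ (z n - p)) * (c ⬝ᵥ (z n₀ - p)) = 0 := by
    rw [← Finset.sum_mul]
    have : ∑ n, m n * (c ⬝ᵥ (z n - p)) = 0 := by
      simp only [dotProduct_sub, mul_sub, Finset.sum_sub_distrib, ← Finset.sum_mul, hm1, ← hsum]
      rw [hr.1.2, one_mul, sub_self]
    rw [this, zero_mul]
  have hterm := (Finset.sum_eq_zero_iff_of_nonneg fun n _ => by
    rcases (hm0 n).eq_or_lt with h | h
    · rw [← h, zero_mul, zero_mul]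
    · by_cases hne : z n = z n₀
      · rw [hne, mul_assoc]
        exact mul_nonneg (hm0 n) (mul_self_nonneg _)
      · rw [hother n h hne, mul_zero, zero_mul]).1 hzero n₀ (Finset.mem_univ _)
  have hne := havoid w (hw ▸ (hz n₀).1) (hw ▸ hn₀i)
  rw [hw] at hne
  exact mul_ne_zero (mul_ne_zero hn₀.ne' hne) hne hterm

/-- If the midpoint of a relative interior lattice point `p` of the facet `i` and a lattice point
`v` of the polyhedron is a lattice point, then `v` lies on the facet `i` and the midpoint lies in
its relative interior. -/
lemma OnlyTight.midpoint (hfree : ∀ z, ¬ ∀ j, A j ⬝ᵥ latticePt z < b j) {i : ι}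
    {p v m : Fin 3 → ℤ} (hp : OnlyTight A b i (latticePt p)) (hv : latticePt v ∈ halfspaces A b)
    (hm : latticePt m = (1 / 2 : ℝ) • (latticePt p + latticePt v)) :
    A i ⬝ᵥ latticePt v = b i ∧ OnlyTight A b i (latticePt m) := by
  have hj : ∀ j, j ≠ i → A j ⬝ᵥ latticePt m < b j := fun j hj => by
    rw [hm, dotProduct_half_add]
    linarith [hp.2 j hj, hv j]
  have hvi : A i ⬝ᵥ latticePt v = b i := by
    refine le_antisymm (hv i) (not_lt.1 fun h => hfree m fun j => ?_)
    by_cases hji : j = i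
    · rw [hji, hm, dotProduct_half_add]
      linarith [hp.1]
    · exact hj j hji
  refine ⟨hvi, ?_, hj⟩
  rw [hm, dotProduct_half_add, hvi, hp.1]
  ring

lemma OnlyTight.parity_ne (hfree : ∀ z, ¬ ∀ j, A j ⬝ᵥ latticePt z < b j) {i : ι}
    {p v : Fin 3 → ℤ} (hp : OnlyTight A b i (latticePt p)) (hv : latticePt v ∈ halfspaces A b)
    (hvi : A i ⬝ᵥ latticePt v < b i) : parity p ≠ parity v := by
  intro h
  obtain ⟨m, hm⟩ := exists_lattice_midpoint h
  exact hvi.ne (hp.midpoint hfree hv hm).1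

/-- The two points of `exists_shareTwo` can be chosen incongruent modulo two. -/
lemma exists_shareTwo_parity_ne [Finite ι] (hbd : Bornology.IsBounded (halfspaces A b))
    (hintegral : IsIntegralPoly (halfspaces A b)) {i : ι} (hA : A i ≠ 0) {p u : Fin 3 → ℝ}
    (hp : OnlyTight A b i p) (hu : u ≠ 0) (hiu : A i ⬝ᵥ u = 0) :
    ∃ w x : Fin 3 → ℤ, latticePt w ∈ halfspaces A b ∧ latticePt x ∈ halfspaces A b ∧
      parity w ≠ parity x ∧ A i ⬝ᵥ latticePt w < b i ∧
      (A i ⬝ᵥ latticePt x < b i ∨ crossProduct u (latticePt x - p) ≠ 0) ∧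
      ShareTwo A b (latticePt w) (latticePt x) := by
  have hfin := finite_lattice_of_isBounded hbd
  obtain ⟨w, x, hw, hx, hwx, hwi, hxi, hs⟩ := exists_shareTwo hbd hintegral hA hp hu hiu
  obtain ⟨⟨w, x⟩, ⟨hw, hx, hwx, hwi, hxi, hs⟩, hmin⟩ := Set.exists_min_image
    {q : (Fin 3 → ℤ) × (Fin 3 → ℤ) | latticePt q.1 ∈ halfspaces A b ∧
      latticePt q.2 ∈ halfspaces A b ∧ q.1 ≠ q.2 ∧ A i ⬝ᵥ latticePt q.1 < b i ∧
      (A i ⬝ᵥ latticePt q.2 < b i ∨ crossProduct u (latticePt q.2 - p) ≠ 0) ∧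
      ShareTwo A b (latticePt q.1) (latticePt q.2)}
    (fun q => ‖latticePt q.1 - latticePt q.2‖)
    ((hfin.prod hfin).subset fun q hq => ⟨hq.1, hq.2.1⟩) ⟨(w, x), hw, hx, hwx, hwi, hxi, hs⟩
  refine ⟨w, x, hw, hx, fun hpar => ?_, hwi, hxi, hs⟩
  obtain ⟨m, hm⟩ := exists_lattice_midpoint hpar
  have hdiff : latticePt w - latticePt m = (1 / 2 : ℝ) • (latticePt w - latticePt x) := by
    rw [hm]
    module
  have hpos : 0 < ‖latticePt w - latticePt x‖ :=
    norm_pos_iff.2 (sub_ne_zero.2 fun h => hwx (latticePt_injective h))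
  have hnorm : ‖latticePt w - latticePt m‖ = ‖latticePt w - latticePt x‖ / 2 := by
    rw [hdiff, norm_smul]
    norm_num
    ring
  have hdot : ∀ j, A j ⬝ᵥ latticePt m = (A j ⬝ᵥ latticePt w + A j ⬝ᵥ latticePt x) / 2 :=
    fun j => by rw [hm, dotProduct_half_add]
  have := hmin (w, m) ⟨hw, fun j => by rw [hdot]; linarith [hw j, hx j], ?_, hwi,
    Or.inl (by rw [hdot]; linarith [hx i]), ?_⟩
  · simp only at this
    linarith
  · intro hwm
    rw [← show w = m from hwm, sub_self, norm_zero] at hnorm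
    linarith
  · obtain ⟨j, k, hjk, h1, h2, h3, h4⟩ := hs
    exact ⟨j, k, hjk, h1, by rw [hdot, h1, h2]; ring, h3, by rw [hdot, h3, h4]; ring⟩

/-- A facet with a relative interior lattice point has one that is incongruent to two given
lattice points with two common tight constraints. -/
lemma exists_onlyTight_parity_ne (hbd : Bornology.IsBounded (halfspaces A b))
    (hfree : ∀ z, ¬ ∀ j, A j ⬝ᵥ latticePt z < b j) {w x : Fin 3 → ℤ}
    (hw : latticePt w ∈ halfspaces A b) (hx : latticePt x ∈ halfspaces A b)
    (hs : ShareTwo A b (latticePt w) (latticePt x)) {k : ι}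
    (hk : ∃ p, OnlyTight A b k (latticePt p)) :
    ∃ p, OnlyTight A b k (latticePt p) ∧ parity p ≠ parity w ∧ parity p ≠ parity x := by
  obtain ⟨l, hlk, hlw, hlx⟩ : ∃ l, l ≠ k ∧ A l ⬝ᵥ latticePt w = b l ∧
      A l ⬝ᵥ latticePt x = b l := by
    obtain ⟨j, j', hjj, h1, h2, h3, h4⟩ := hs
    by_cases h : j = k
    · exact ⟨j', fun h' => hjj (h.trans h'.symm), h3, h4⟩
    · exact ⟨j, h, h1, h2⟩
  obtain ⟨p, hp, hmin⟩ := Set.exists_min_image {p | OnlyTight A b k (latticePt p)}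
    (fun p => b l - A l ⬝ᵥ latticePt p)
    ((finite_lattice_of_isBounded hbd).subset fun p hp => OnlyTight.mem hp) hk
  have key : ∀ v, latticePt v ∈ halfspaces A b → A l ⬝ᵥ latticePt v = b l →
      parity p ≠ parity v := by
    intro v hv hlv hpar
    obtain ⟨m, hm⟩ := exists_lattice_midpoint hpar
    have h1 := hmin m (OnlyTight.midpoint hfree hp hv hm).2
    have h2 := hp.2 l hlk
    rw [hm, dotProduct_half_add, hlv] at h1
    linarith
  exact ⟨p, hp, key w hw hlw, key x hx hlx⟩

/-- If a facet has two relative interior lattice points, it has two incongruent ones that are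
also incongruent to a given lattice point that is either off the facet or off the line through
the two points. -/
lemma exists_pair_onlyTight_parity_ne (hbd : Bornology.IsBounded (halfspaces A b))
    (hfree : ∀ z, ¬ ∀ j, A j ⬝ᵥ latticePt z < b j) {i : ι} {p q x : Fin 3 → ℤ}
    (hp : OnlyTight A b i (latticePt p)) (hq : OnlyTight A b i (latticePt q)) (hpq : p ≠ q)
    (hx : latticePt x ∈ halfspaces A b)
    (hxi : A i ⬝ᵥ latticePt x < b i ∨
      crossProduct (latticePt q - latticePt p) (latticePt x - latticePt p) ≠ 0) :
    ∃ p' q', OnlyTight A b i (latticePt p') ∧ OnlyTight A b i (latticePt q') ∧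
      parity p' ≠ parity q' ∧ parity p' ≠ parity x ∧ parity q' ≠ parity x := by
  have hfin : {p | OnlyTight A b i (latticePt p)}.Finite :=
    (finite_lattice_of_isBounded hbd).subset fun p hp => OnlyTight.mem hp
  rcases hxi with hxi | hxi
  · obtain ⟨q', ⟨hq', hne⟩, hmin⟩ := Set.exists_min_image
      {q | OnlyTight A b i (latticePt q) ∧ q ≠ p} (fun q => ‖latticePt p - latticePt q‖)
      (hfin.subset fun q hq => hq.1) ⟨q, hq, hpq.symm⟩
    refine ⟨p, q', hp, hq', fun hpar => ?_, hp.parity_ne hfree hx hxi,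
      hq'.parity_ne hfree hx hxi⟩
    obtain ⟨m, hm⟩ := exists_lattice_midpoint hpar
    have hpos : 0 < ‖latticePt p - latticePt q'‖ :=
      norm_pos_iff.2 (sub_ne_zero.2 fun h => hne (latticePt_injective h).symm)
    have hnorm : ‖latticePt p - latticePt m‖ = ‖latticePt p - latticePt q'‖ / 2 := by
      have : latticePt p - latticePt m = (1 / 2 : ℝ) • (latticePt p - latticePt q') := by
        rw [hm]
        module
      rw [this, norm_smul]
      norm_num
      ring
    have := hmin m ⟨(hp.midpoint hfree hq'.mem hm).2, ?_⟩
    · linarith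
    · rintro rfl
      rw [sub_self, norm_zero] at hnorm
      linarith
  · have hbil : crossProduct (latticePt p - latticePt x) (latticePt q - latticePt x) =
        crossProduct (latticePt q - latticePt p) (latticePt x - latticePt p) := by
      ext l
      fin_cases l <;> simp [cross_apply] <;> ring
    obtain ⟨⟨p', q'⟩, ⟨hp', hq', hne⟩, hmin⟩ := Set.exists_min_image
      {r : (Fin 3 → ℤ) × (Fin 3 → ℤ) | OnlyTight A b i (latticePt r.1) ∧
        OnlyTight A b i (latticePt r.2) ∧
        crossProduct (latticePt r.1 - latticePt x) (latticePt r.2 - latticePt x) ≠ 0}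
      (fun r => ‖crossProduct (latticePt r.1 - latticePt x) (latticePt r.2 - latticePt x)‖)
      ((hfin.prod hfin).subset fun r hr => ⟨hr.1, hr.2.1⟩) ⟨(p, q), hp, hq, hbil ▸ hxi⟩
    have key : ∀ p₁ q₁, OnlyTight A b i (latticePt p₁) → OnlyTight A b i (latticePt q₁) →
        crossProduct (latticePt p₁ - latticePt x) (latticePt q₁ - latticePt x) ≠
          (1 / 2 : ℝ) • crossProduct (latticePt p' - latticePt x) (latticePt q' - latticePt x) := by
      intro p₁ q₁ hp₁ hq₁ h
      have h1 := hmin (p₁, q₁)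
        ⟨hp₁, hq₁, by simp only; rw [h]; exact smul_ne_zero (by norm_num) hne⟩
      simp only at h1
      rw [h, norm_smul] at h1
      have h2 := norm_pos_iff.2 hne
      simp only at h2
      rw [Real.norm_of_nonneg (by norm_num)] at h1
      linarith
    refine ⟨p', q', hp', hq', fun hpar => ?_, fun hpar => ?_, fun hpar => ?_⟩
    all_goals obtain ⟨m, hm⟩ := exists_lattice_midpoint hpar
    · refine key p' m hp' (hp'.midpoint hfree hq'.mem hm).2 ?_
      have : latticePt m - latticePt x = (1 / 2 : ℝ) • (latticePt p' - latticePt x) +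
          (1 / 2 : ℝ) • (latticePt q' - latticePt x) := by
        rw [hm]
        module
      rw [this, map_add, map_smul, map_smul, cross_self, smul_zero, zero_add]
    · refine key m q' (hp'.midpoint hfree hx hm).2 hq' ?_
      have : latticePt m - latticePt x = (1 / 2 : ℝ) • (latticePt p' - latticePt x) := by
        rw [hm]
        module
      rw [this, map_smul, LinearMap.smul_apply]
    · refine key p' m hp' (hq'.midpoint hfree hx hm).2 ?_
      have : latticePt m - latticePt x = (1 / 2 : ℝ) • (latticePt q' - latticePt x) := by
        rw [hm]
        module
      rw [this, map_smul]

/-- Relative interior lattice points of distinct facets, two further lattice points, and any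
set of other parity classes: together there are at most eight classes. -/
lemma card_add_two_le [Fintype ι] (hfree : ∀ z, ¬ ∀ j, A j ⬝ᵥ latticePt z < b j)
    {p : ι → Fin 3 → ℤ} (hp : ∀ k, OnlyTight A b k (latticePt (p k))) {w x : Fin 3 → ℤ}
    (hwx : parity w ≠ parity x) (hpw : ∀ k, parity (p k) ≠ parity w)
    (hpx : ∀ k, parity (p k) ≠ parity x) :
    Fintype.card ι + 2 ≤ 8 ∧ ∀ q, parity q ≠ parity w → parity q ≠ parity x →
      (∀ k, parity q ≠ parity (p k)) → Fintype.card ι + 3 ≤ 8 := by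
  classical
  have hinj : Function.Injective fun k => parity (p k) := by
    intro k l hkl
    by_contra hne
    exact (hp k).parity_ne hfree (hp l).mem ((hp l).2 k hne) hkl
  have hcard : ∀ s : Finset (Fin 3 → ZMod 2), s.card ≤ 8 := fun s => by
    simpa using s.card_le_univ
  set s := Finset.univ.image fun k => parity (p k) with hs
  have hsc : s.card = Fintype.card ι := by
    rw [hs, Finset.card_image_of_injective _ hinj, Finset.card_univ]
  have hx : parity x ∉ s := by
    simpa [hs] using hpx
  have hw : parity w ∉ insert (parity x) s := by
    simpa [hs, hwx] using hpw
  refine ⟨?_, fun q hqw hqx hqp => ?_⟩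
  · have := hcard (insert (parity w) (insert (parity x) s))
    rwa [Finset.card_insert_of_notMem hw, Finset.card_insert_of_notMem hx, hsc] at this
  · have hq : parity q ∉ insert (parity w) (insert (parity x) s) := by
      simpa [hs, hqw, hqx, eq_comm] using hqp
    have := hcard (insert (parity q) (insert (parity w) (insert (parity x) s)))
    rwa [Finset.card_insert_of_notMem hq, Finset.card_insert_of_notMem hw,
      Finset.card_insert_of_notMem hx, hsc] at this

/-- If every facet of a lattice-free integral polytope has a relative interior lattice point,
there are at most six facets. -/
lemma card_le_six [Fintype ι] (hbd : Bornology.IsBounded (halfspaces A b))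
    (hintegral : IsIntegralPoly (halfspaces A b)) (hA : ∀ i, A i ≠ 0)
    (hfree : ∀ z, ¬ ∀ j, A j ⬝ᵥ latticePt z < b j)
    (hlov : ∀ i, ∃ z, OnlyTight A b i (latticePt z)) : Fintype.card ι ≤ 6 := by
  rcases isEmpty_or_nonempty ι with h | ⟨⟨i⟩⟩
  · simp
  obtain ⟨z, hz⟩ := hlov i
  obtain ⟨u, hu0, hu⟩ := Matrix.exists_mulVec_eq_zero_iff.2
    (show (Matrix.of ![A i, A i, A i]).det = 0 from
      Matrix.det_zero_of_row_eq (i := 1) (j := 2) (by decide) (by rfl))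
  obtain ⟨w, x, hw, hx, hwx, -, -, hs⟩ :=
    exists_shareTwo_parity_ne hbd hintegral (hA i) hz hu0 (congrFun hu 0)
  choose p hp hpw hpx using fun k => exists_onlyTight_parity_ne hbd hfree hw hx hs (hlov k)
  have := (card_add_two_le hfree hp hwx hpw hpx).1
  omega

/-- If there are at least six facets, then the relative interior lattice points are unique. -/
lemma onlyTight_unique [Fintype ι] (hbd : Bornology.IsBounded (halfspaces A b))
    (hintegral : IsIntegralPoly (halfspaces A b)) (hA : ∀ i, A i ≠ 0)
    (hfree : ∀ z, ¬ ∀ j, A j ⬝ᵥ latticePt z < b j)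
    (hlov : ∀ i, ∃ z, OnlyTight A b i (latticePt z)) (hcard : 6 ≤ Fintype.card ι)
    {i : ι} {y z : Fin 3 → ℤ} (hy : OnlyTight A b i (latticePt y))
    (hz : OnlyTight A b i (latticePt z)) : y = z := by
  classical
  by_contra hyz
  obtain ⟨w, x, hw, hx, hwx, hwi, hxi, hs⟩ :=
    exists_shareTwo_parity_ne hbd hintegral (hA i) hy (u := latticePt z - latticePt y)
      (sub_ne_zero.2 fun h => hyz (latticePt_injective h).symm)
      (by rw [dotProduct_sub, hy.1, hz.1, sub_self])
  obtain ⟨p', q', hp', hq', hpq, hpx', hqx'⟩ :=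
    exists_pair_onlyTight_parity_ne hbd hfree hy hz hyz hx hxi
  choose p hp hpw hpx using fun k => exists_onlyTight_parity_ne hbd hfree hw hx hs (hlov k)
  have h1 : ∀ k, OnlyTight A b k (latticePt (Function.update p i p' k)) ∧
      parity (Function.update p i p' k) ≠ parity w ∧
      parity (Function.update p i p' k) ≠ parity x ∧
      parity q' ≠ parity (Function.update p i p' k) := by
    intro k
    by_cases hk : k = i
    · subst hk
      rw [Function.update_self]
      exact ⟨hp', hp'.parity_ne hfree hw hwi, hpx', hpq.symm⟩
    · rw [Function.update_of_ne hk]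
      exact ⟨hp k, hpw k, hpx k, hq'.parity_ne hfree (hp k).mem ((hp k).2 i (Ne.symm hk))⟩
  have := (card_add_two_le hfree (fun k => (h1 k).1) hwx (fun k => (h1 k).2.1)
    (fun k => (h1 k).2.2.1)).2 q' (hq'.parity_ne hfree hw hwi) hqx' (fun k => (h1 k).2.2.2)
  omega

/-- From a relative interior point of `F` one can move a little away from any point of the
affine span of `F` without leaving `F`. -/
lemma exists_extend_of_mem_intrinsicInterior {F : Set (Fin 3 → ℝ)} {x y : Fin 3 → ℝ}
    (hx : x ∈ intrinsicInterior ℝ F) (hy : y ∈ affineSpan ℝ F) :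
    ∃ δ > (0 : ℝ), x + δ • (x - y) ∈ F := by
  obtain ⟨x', hx', rfl⟩ := mem_intrinsicInterior.1 hx
  have hmem : ∀ s : ℝ, (x' : Fin 3 → ℝ) + s • ((x' : Fin 3 → ℝ) - y) ∈ affineSpan ℝ F := by
    intro s
    have := AffineSubspace.vadd_mem_of_mem_direction (Submodule.smul_mem _ s
      (AffineSubspace.vsub_mem_direction x'.2 hy)) x'.2
    rwa [vadd_eq_add, vsub_eq_sub, add_comm] at this
  have hc : Continuous fun s : ℝ => (⟨_, hmem s⟩ : affineSpan ℝ F) :=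
    Continuous.subtype_mk (by fun_prop) _
  have h1 : ∀ᶠ s in nhds (0 : ℝ), (⟨_, hmem s⟩ : affineSpan ℝ F) ∈ Subtype.val ⁻¹' F := by
    refine (hc.tendsto 0).eventually ?_
    have : (⟨_, hmem 0⟩ : affineSpan ℝ F) = x' := by
      ext1
      simp
    rw [this]
    exact mem_interior_iff_mem_nhds.1 hx'
  obtain ⟨ε, hε, H⟩ := Metric.eventually_nhds_iff.1 h1
  refine ⟨ε / 2, half_pos hε, H ?_⟩
  rw [Real.dist_eq, sub_zero, abs_of_pos (half_pos hε)]
  linarith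

lemma mem_openSegment_extend (x y : Fin 3 → ℝ) {δ : ℝ} (hδ : 0 < δ) :
    x ∈ openSegment ℝ y (x + δ • (x - y)) := by
  have h : 1 + δ ≠ 0 := by positivity
  refine ⟨δ / (1 + δ), 1 / (1 + δ), by positivity, by positivity, by field_simp; ring, ?_⟩
  ext l
  simp only [Pi.add_apply, Pi.smul_apply, Pi.sub_apply, smul_eq_mul]
  field_simp
  ring

/-- Every facet is cut out by one of the constraints. -/
lemma IsFacet.exists_eq [Finite ι] (hA : ∀ i, A i ≠ 0) (hne : (interior (halfspaces A b)).Nonempty)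
    {F : Set (Fin 3 → ℝ)} (hF : IsFacet (halfspaces A b) F) :
    ∃ i, F = halfspaces A b ∩ {x | A i ⬝ᵥ x = b i} ∧
      (affineSpan ℝ F : Set (Fin 3 → ℝ)) ⊆ {x | A i ⬝ᵥ x = b i} := by
  obtain ⟨hext, hconv, hrank⟩ := hF
  have hFne : F.Nonempty := by
    by_contra h
    rw [Set.not_nonempty_iff_eq_empty] at h
    rw [h, vectorSpan_empty] at hrank
    simp at hrank
  obtain ⟨z, hz⟩ := Set.Nonempty.intrinsicInterior hconv hFne
  have hzF : z ∈ F := intrinsicInterior_subset hz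
  obtain ⟨i, hi⟩ : ∃ i, A i ⬝ᵥ z = b i := by
    by_contra! hcon
    have hlt : ∀ j, A j ⬝ᵥ z < b j := fun j => lt_of_le_of_ne (hext.subset hzF j) (hcon j)
    have hsub : halfspaces A b ⊆ F := by
      intro y hy
      obtain ⟨ε, hε, H⟩ := exists_pos_strict (A := A) (b := b) z (z - y)
      exact hext.left_mem_of_mem_openSegment hy
        (fun j => (H ε (abs_of_pos hε).le j (hlt j)).le) hzF (mem_openSegment_extend z y hε)
    have htop : affineSpan ℝ F = ⊤ := by
      refine affineSpan_eq_top_of_nonempty_interior ?_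
      rw [hconv.convexHull_eq]
      exact hne.mono (interior_mono hsub)
    rw [← direction_affineSpan, htop, AffineSubspace.direction_top] at hrank
    simp at hrank
  have hFi : F ⊆ {x | A i ⬝ᵥ x = b i} := by
    intro y hy
    obtain ⟨δ, hδ, h⟩ := exists_extend_of_mem_intrinsicInterior hz (subset_affineSpan ℝ F hy)
    have h1 := hext.subset h i
    rw [dotProduct_add, dotProduct_smul, dotProduct_sub, hi, smul_eq_mul] at h1
    have h2 : b i - A i ⬝ᵥ y ≤ 0 := by
      by_contra! h3
      linarith [mul_pos hδ h3]
    exact le_antisymm (hext.subset hy i) (by linarith)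
  set f : Module.Dual ℝ (Fin 3 → ℝ) := dotProductBilin ℝ ℝ (A i) with hf
  have hfx : ∀ x, f x = A i ⬝ᵥ x := fun x => rfl
  have hle : vectorSpan ℝ F ≤ LinearMap.ker f := by
    rw [vectorSpan, Submodule.span_le]
    rintro _ ⟨x, hx, y, hy, rfl⟩
    have hx' : A i ⬝ᵥ x = b i := hFi hx
    have hy' : A i ⬝ᵥ y = b i := hFi hy
    rw [SetLike.mem_coe, LinearMap.mem_ker, hfx]
    simp only [vsub_eq_sub]
    rw [dotProduct_sub, hx', hy', sub_self]
  have hf0 : f ≠ 0 := by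
    intro h
    have := dotProduct_self_pos (hA i)
    rw [← hfx, h] at this
    simp at this
  have hker : Module.finrank ℝ (LinearMap.ker f) = 2 := by
    have := Module.Dual.finrank_ker_add_one_of_ne_zero hf0
    rw [Module.finrank_fin_fun] at this
    omega
  have hspan : vectorSpan ℝ F = LinearMap.ker f :=
    Submodule.eq_of_le_of_finrank_eq hle (hrank.trans hker.symm)
  have hzspan := subset_affineSpan ℝ F hzF
  refine ⟨i, Set.Subset.antisymm (fun y hy => ⟨hext.subset hy, hFi hy⟩) ?_, fun y hy => ?_⟩
  · rintro y ⟨hy, hyi⟩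
    have hyspan : y ∈ affineSpan ℝ F := by
      have hd : y - z ∈ (affineSpan ℝ F).direction := by
        rw [direction_affineSpan, hspan, LinearMap.mem_ker, hfx, dotProduct_sub, hi,
          show A i ⬝ᵥ y = b i from hyi, sub_self]
      simpa using AffineSubspace.vadd_mem_of_mem_direction hd hzspan
    obtain ⟨δ, hδ, h⟩ := exists_extend_of_mem_intrinsicInterior hz hyspan
    exact hext.left_mem_of_mem_openSegment hy (hext.subset h) hzF (mem_openSegment_extend z y hδ)
  · have hd := AffineSubspace.vsub_mem_direction hy hzspan
    rw [direction_affineSpan, hspan, LinearMap.mem_ker, hfx, vsub_eq_sub, dotProduct_sub, hi] at hd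
    simp only [mem_ofPred_eq]
    linarith

/-- The relative interior of a facet consists of the points where only its constraint is
tight. -/
lemma mem_intrinsicInterior_facet_iff [Finite ι] {i : ι} {F : Set (Fin 3 → ℝ)}
    (hF : F = halfspaces A b ∩ {x | A i ⬝ᵥ x = b i})
    (hspan : (affineSpan ℝ F : Set (Fin 3 → ℝ)) ⊆ {x | A i ⬝ᵥ x = b i})
    {q : Fin 3 → ℝ} (hq : OnlyTight A b i q) {x : Fin 3 → ℝ} :
    x ∈ intrinsicInterior ℝ F ↔ OnlyTight A b i x := by
  constructor
  · intro hx
    have hxF := intrinsicInterior_subset hx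
    have hqF : q ∈ F := hF ▸ ⟨hq.mem, hq.1⟩
    obtain ⟨δ, hδ, h⟩ := exists_extend_of_mem_intrinsicInterior hx (subset_affineSpan ℝ F hqF)
    rw [hF] at hxF h
    refine ⟨hxF.2, fun j hj => ?_⟩
    have h1 := h.1 j
    rw [dotProduct_add, dotProduct_smul, dotProduct_sub, smul_eq_mul] at h1
    by_contra! h2
    have := mul_pos hδ (sub_pos.2 ((hq.2 j hj).trans_le h2))
    linarith
  · intro hx
    have hxF : x ∈ F := hF ▸ ⟨hx.mem, hx.1⟩
    refine mem_intrinsicInterior.2 ⟨⟨x, subset_affineSpan ℝ F hxF⟩, ?_, rfl⟩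
    have ho : IsOpen (⋂ j, {y | j ≠ i → A j ⬝ᵥ y < b j}) := by
      refine isOpen_iInter_of_finite fun j => ?_
      by_cases hj : j = i
      · simp [hj]
      · simpa [hj] using isOpen_lt (continuous_dotProduct_left (A j)) continuous_const
    refine mem_interior.2 ⟨_, ?_, ho.preimage continuous_subtype_val, mem_iInter.2 hx.2⟩
    intro y hy
    have hyi : A i ⬝ᵥ (y : Fin 3 → ℝ) = b i := hspan y.2
    have hyO : OnlyTight A b i y := ⟨hyi, fun j => mem_iInter.1 hy j⟩
    rw [mem_preimage]
    exact hF.ge ⟨hyO.mem, hyi⟩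

end Polyhedra

/-- A polyhedron is cut out by an irredundant finite system of linear inequalities. -/
lemma IsPolyhedron.exists_irredundant {P : Set (Fin 3 → ℝ)} (hP : IsPolyhedron P) :
    ∃ (n : ℕ) (A : Fin n → Fin 3 → ℝ) (b : Fin n → ℝ), P = halfspaces A b ∧
      ∀ i, ∃ z, (∀ j, j ≠ i → A j ⬝ᵥ z ≤ b j) ∧ b i < A i ⬝ᵥ z := by
  classical
  have hP' : ∃ n, ∃ (A : Fin n → Fin 3 → ℝ) (b : Fin n → ℝ), P = halfspaces A b := hP
  obtain ⟨A, b, hAb⟩ := Nat.find_spec hP'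
  refine ⟨_, A, b, hAb, fun i => ?_⟩
  by_contra! hcon
  obtain ⟨m, hm⟩ : ∃ m, Nat.find hP' = m + 1 := Nat.exists_eq_succ_of_ne_zero i.pos.ne'
  refine Nat.find_min hP' (m := m) (by omega) ?_
  revert A b i
  rw [hm]
  intro A b hAb i hcon
  refine ⟨fun j => A (i.succAbove j), fun j => b (i.succAbove j), ?_⟩
  rw [hAb]
  ext x
  refine ⟨fun hx j => hx _, fun hx => ?_⟩
  have h1 : ∀ j, j ≠ i → A j ⬝ᵥ x ≤ b j := fun j hj => by
    obtain ⟨k, rfl⟩ := Fin.exists_succAbove_eq hj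
    exact hx k
  intro j
  by_cases hj : j = i
  · exact hj ▸ hcon x h1
  · exact h1 j hj

/-- Every maximal lattice-free integral polytope in `ℝ³` has at most six facets; if it has
exactly six facets, then each facet contains exactly one integer point in its relative
interior. -/
theorem M3_at_most_six_facets (P : Set (Fin 3 → ℝ)) (hP : MemM3 P) :
    {F : Set (Fin 3 → ℝ) | IsFacet P F}.Finite ∧
    {F : Set (Fin 3 → ℝ) | IsFacet P F}.ncard ≤ 6 ∧
    ({F : Set (Fin 3 → ℝ) | IsFacet P F}.ncard = 6 →
      ∀ F : Set (Fin 3 → ℝ), IsFacet P F →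
        ∃! x : Fin 3 → ℝ, x ∈ intrinsicInterior ℝ F ∩ intPts 3) := by
  obtain ⟨hpoly, hbd, hintegral, hne, hfreeP, hmax⟩ := hP
  obtain ⟨n, A, b, rfl, hirr⟩ := hpoly.exists_irredundant
  obtain ⟨o, ho⟩ := hne
  have hA : ∀ i, A i ≠ 0 := by
    intro i h
    obtain ⟨z, -, hz⟩ := hirr i
    have := interior_subset ho i
    rw [h, zero_dotProduct] at this hz
    linarith
  have hfree : ∀ z, ¬ ∀ j, A j ⬝ᵥ latticePt z < b j := fun z hz =>
    (hfreeP.subset ⟨mem_interior_halfspaces hz, range_latticePt ▸ mem_range_self z⟩).elim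
  have hlov : ∀ i, ∃ z, OnlyTight A b i (latticePt z) := by
    intro i
    obtain ⟨z, hz, hzi⟩ := hirr i
    obtain ⟨q, hq⟩ := exists_onlyTight
      (fun j => dotProduct_lt_of_mem_interior (s := halfspaces A b) (hA j) (fun y hy => hy j) ho) hz hzi
    exact exists_lattice_onlyTight hbd hA hfree hmax hq
  have hcard := card_le_six hbd hintegral hA hfree hlov
  have hsub : {F | IsFacet (halfspaces A b) F} ⊆
      range fun i => halfspaces A b ∩ {x | A i ⬝ᵥ x = b i} := by
    intro F hF
    obtain ⟨i, hi, -⟩ := IsFacet.exists_eq hA ⟨o, ho⟩ hF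
    exact ⟨i, hi.symm⟩
  have hncard : {F | IsFacet (halfspaces A b) F}.ncard ≤ Fintype.card (Fin n) := by
    refine (Set.ncard_le_ncard hsub (Set.finite_range _)).trans ?_
    rw [← Set.image_univ, ← Nat.card_eq_fintype_card, ← Set.ncard_univ]
    exact Set.ncard_image_le
  refine ⟨(Set.finite_range _).subset hsub, hncard.trans hcard, fun h6 F hF => ?_⟩
  obtain ⟨i, hi, hspan⟩ := IsFacet.exists_eq hA ⟨o, ho⟩ hF
  obtain ⟨z, hz⟩ := hlov i
  refine ⟨latticePt z, ⟨(mem_intrinsicInterior_facet_iff hi hspan hz).2 hz,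
    range_latticePt ▸ mem_range_self z⟩, ?_⟩
  rintro y ⟨hy, hyZ⟩
  rw [← range_latticePt] at hyZ
  obtain ⟨y, rfl⟩ := hyZ
  rw [onlyTight_unique hbd hintegral hA hfree hlov (h6 ▸ hncard)
    ((mem_intrinsicInterior_facet_iff hi hspan hz).1 hy) hz]
end
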